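/- arXiv:math/0702742 — 12 statements merged into one kernel-verified Lean document; each statement's English description precedes it below -/
import Mathlib

section
/- Let F be a finite field with q elements and let C be a field extension of F. Fix r ∈ F and integers l, t with 1 ≤ l ≤ q-2 and 1 ≤ t ≤ q-2, and let X : F → C be any function. Then the double sum Σ_{b∈F} Σ_{s∈F, s≠b} (b-r)^t · (s-b)^{-l} · X(s) equals: (i) (-1)^{l+1} · binom(t,l) · Σ_{s∈F} (s-r)^{t-l} X(s) if t > l; (ii) (-1)^{l+1} · Σ_{s∈F} X(s) if t = l; (iii) 0 if t < l. (Here binom(t,l) denotes the binomial coefficient reduced into F, and (s-b)^{-l} is the l-th power of the inverse of s-b in F ⊆ C.) -/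
open Finset

theorem FiniteField.sum_pow_mul_inv_pow {F : Type*} [Field F] [Fintype F] [DecidableEq F]
    {k l : ℕ} (hl : 1 ≤ l) (hlq : l ≤ Fintype.card F - 2) (hkq : k ≤ Fintype.card F - 2) :
    ∑ u : F, u ^ k * u⁻¹ ^ l = if k = l then -1 else 0 := by
  have hl0 : l ≠ 0 := by omega
  rcases lt_trichotomy k l with h | rfl | h
  · rw [if_neg h.ne,
      ← FiniteField.sum_pow_lt_card_sub_one F (k + (Fintype.card F - 1 - l)) (by omega)]
    refine Finset.sum_congr rfl fun u _ => ?_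
    rcases eq_or_ne u 0 with rfl | hu
    · rw [inv_zero, zero_pow hl0, mul_zero, zero_pow (by omega)]
    · rw [pow_add, inv_pow]
      refine congrArg _ ?_
      refine inv_eq_of_mul_eq_one_right ?_
      rw [← pow_add, show l + (Fintype.card F - 1 - l) = Fintype.card F - 1 by omega]
      exact FiniteField.pow_card_sub_one_eq_one u hu
  · have hterm (u : F) : u ^ k * u⁻¹ ^ k = 1 - if u = 0 then 1 else 0 := by
      rcases eq_or_ne u 0 with rfl | hu
      · simp [hl0]
      · simp [hu]
    simp only [hterm]
    simp
  · rw [if_neg h.ne', ← FiniteField.sum_pow_lt_card_sub_one F (k - l) (by omega)]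
    refine Finset.sum_congr rfl fun u _ => ?_
    rcases eq_or_ne u 0 with rfl | hu
    · rw [inv_zero, zero_pow hl0, mul_zero, zero_pow (by omega)]
    · rw [pow_sub₀ u hu h.le, inv_pow]

theorem FiniteField.sum_sub_pow_mul_inv_sub_pow {F : Type*} [Field F] [Fintype F] [DecidableEq F]
    {t l : ℕ} (hl : 1 ≤ l) (hlq : l ≤ Fintype.card F - 2) (htq : t ≤ Fintype.card F - 2) (r s : F) :
    ∑ b : F, (b - r) ^ t * (s - b)⁻¹ ^ l =
      (-1) ^ (l + 1) * (t.choose l : F) * (s - r) ^ (t - l) := by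
  have hterm (u : F) : (s - u - r) ^ t * (s - (s - u))⁻¹ ^ l =
      ∑ k ∈ Finset.range (t + 1),
        (-1) ^ k * (s - r) ^ (t - k) * (t.choose k : F) * (u ^ k * u⁻¹ ^ l) := by
    rw [sub_sub_cancel, show s - u - r = -u + (s - r) by ring, add_pow, Finset.sum_mul]
    refine Finset.sum_congr rfl fun k _ => ?_
    rw [neg_pow]
    ring
  rw [← Equiv.sum_comp (Equiv.subLeft s)]
  simp only [Equiv.subLeft_apply, hterm]
  rw [Finset.sum_comm]
  simp only [← Finset.mul_sum]
  have hsum : ∀ k ∈ Finset.range (t + 1),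
      (-1) ^ k * (s - r) ^ (t - k) * (t.choose k : F) * ∑ u : F, u ^ k * u⁻¹ ^ l =
        if k = l then (-1) ^ (l + 1) * (t.choose l : F) * (s - r) ^ (t - l) else 0 := by
    intro k hk
    rw [FiniteField.sum_pow_mul_inv_pow hl hlq (by have := Finset.mem_range.mp hk; omega)]
    split_ifs with h
    · subst h
      ring
    · ring
  rw [Finset.sum_congr rfl hsum, Finset.sum_ite_eq']
  split_ifs with h
  · rfl
  · rw [Nat.choose_eq_zero_of_lt (by simpa using h)]
    simp

/-- Proposition 8.5 (Prop. `intersum`) of Li–Meemark: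
for a finite field `F` with `q` elements, a field extension `C` of `F`,
`r ∈ F`, `1 ≤ l, t ≤ q - 2`, and any function `X : F → C`, the double sum
`Σ_{b ∈ F} Σ_{s ≠ b} (b - r)^t (s - b)^{-l} X(s)` equals
`(-1)^{l+1} binom(t,l) Σ_s (s - r)^{t-l} X(s)` if `t > l`,
`(-1)^{l+1} Σ_s X(s)` if `t = l`, and `0` if `t < l`. -/
theorem stmt_0 (F : Type*) [Field F] [Fintype F] [DecidableEq F] (q : ℕ) (hq : Fintype.card F = q)
    (C : Type*) [Field C] [Algebra F C]
    (r : F) (l t : ℕ) (hl1 : 1 ≤ l) (hl2 : l ≤ q - 2) (ht1 : 1 ≤ t) (ht2 : t ≤ q - 2)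
    (X : F → C) :
    (t > l →
      ∑ b : F, ∑ s ∈ Finset.univ.erase b,
          algebraMap F C ((b - r) ^ t * ((s - b)⁻¹) ^ l) * X s =
        algebraMap F C ((-1) ^ (l + 1) * (t.choose l : F)) *
          ∑ s : F, algebraMap F C ((s - r) ^ (t - l)) * X s) ∧
    (t = l →
      ∑ b : F, ∑ s ∈ Finset.univ.erase b,
          algebraMap F C ((b - r) ^ t * ((s - b)⁻¹) ^ l) * X s =
        algebraMap F C ((-1) ^ (l + 1)) * ∑ s : F, X s) ∧
    (t < l →
      ∑ b : F, ∑ s ∈ Finset.univ.erase b,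
          algebraMap F C ((b - r) ^ t * ((s - b)⁻¹) ^ l) * X s = 0) := by
  subst hq
  have key : ∑ b : F, ∑ s ∈ Finset.univ.erase b,
      algebraMap F C ((b - r) ^ t * ((s - b)⁻¹) ^ l) * X s =
        algebraMap F C ((-1) ^ (l + 1) * (t.choose l : F)) *
          ∑ s : F, algebraMap F C ((s - r) ^ (t - l)) * X s := by
    have herase (b : F) : ∑ s ∈ Finset.univ.erase b,
        algebraMap F C ((b - r) ^ t * ((s - b)⁻¹) ^ l) * X s =
          ∑ s : F, algebraMap F C ((b - r) ^ t * ((s - b)⁻¹) ^ l) * X s := by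
      refine Finset.sum_erase _ ?_
      rw [sub_self, inv_zero, zero_pow (by omega), mul_zero, map_zero, zero_mul]
    simp only [herase]
    rw [Finset.sum_comm, Finset.mul_sum]
    refine Finset.sum_congr rfl fun s _ => ?_
    rw [← Finset.sum_mul, ← map_sum, FiniteField.sum_sub_pow_mul_inv_sub_pow hl1 hl2 ht2,
      map_mul, mul_assoc]
  refine ⟨fun _ => key, fun h => ?_, fun h => ?_⟩
  · rw [key, h]
    simp
  · rw [key, Nat.choose_eq_zero_of_lt h]
    simp
end

section
/- Let F be a finite field with q elements and characteristic p, and let a be a generator of the cyclic group F^× of units. For all integers j and l with 1 ≤ j ≤ q-1 and 1 ≤ l ≤ q-2, one has Σ_{n=1}^{q-2} a^{jn} · (1 - a^n)^{-l} = (-1)^{l-1} · binom(j,l) in F, where binom(j,l) denotes the binomial coefficient reduced modulo p into F. -/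
/-- A sum over a field of a function vanishing at `0` is the sum over its units. -/
theorem sum_eq_sum_units_of_zero {F M : Type*} [Field F] [Fintype F] [DecidableEq F]
    [AddCommMonoid M] (f : F → M) (hf : f 0 = 0) : ∑ x, f x = ∑ u : Fˣ, f u := by
  symm
  refine Finset.sum_of_injOn (fun u : Fˣ => (u : F)) Units.val_injective.injOn
    (by simp) ?_ (by simp)
  intro x _ hx
  have : x = 0 := by
    by_contra h
    exact hx ⟨Units.mk0 x h, by simp, rfl⟩
  rw [this, hf]

/-- A sum over a finite cyclic group as a sum over powers of a generator. -/
theorem sum_eq_sum_range_pow {G M : Type*} [Group G] [Fintype G] [AddCommMonoid M] (a : G)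
    (ha : ∀ x : G, x ∈ Subgroup.zpowers a) (f : G → M) :
    ∑ x, f x = ∑ n ∈ Finset.range (Fintype.card G), f (a ^ n) := by
  classical
  have hcard : orderOf a = Fintype.card G := by
    rw [orderOf_eq_card_of_forall_mem_zpowers ha, Nat.card_eq_fintype_card]
  rw [← IsCyclic.image_range_orderOf ha, Finset.sum_image, hcard]
  intro m hm n hn h
  exact pow_injOn_Iio_orderOf (by simpa using hm) (by simpa using hn) h

/-- The power sum of `(1 - u) ^ j * u ^ (-l)` over the units of a finite field. -/
theorem sum_units_one_sub_pow_mul_inv_pow {F : Type*} [Field F] [Fintype F] [DecidableEq F]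
    (j l : ℕ) (hj : j ≤ Fintype.card F - 1) (hl1 : 1 ≤ l) (hl2 : l ≤ Fintype.card F - 2) :
    ∑ u : Fˣ, (1 - (u : F)) ^ j * ((u : F)⁻¹) ^ l = (-1) ^ (l - 1) * (j.choose l : F) := by
  have hexpand : ∀ u : Fˣ, (1 - (u : F)) ^ j * ((u : F)⁻¹) ^ l =
      ∑ k ∈ Finset.range (j + 1), ((-1) ^ k * (j.choose k : F)) *
        (u : F) ^ (k + (Fintype.card F - 1 - l)) := by
    intro u
    have hinv : ((u : F)⁻¹) ^ l = (u : F) ^ (Fintype.card F - 1 - l) := by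
      rw [inv_pow]
      refine inv_eq_of_mul_eq_one_right ?_
      rw [← pow_add, Nat.add_sub_cancel' (by omega), FiniteField.pow_card_sub_one_eq_one _ u.ne_zero]
    rw [hinv, sub_eq_neg_add, add_pow, Finset.sum_mul]
    refine Finset.sum_congr rfl fun k _ => ?_
    rw [neg_pow, one_pow, pow_add]
    ring
  simp_rw [hexpand]
  rw [Finset.sum_comm]
  simp_rw [← Finset.mul_sum]
  have hsum : ∀ k ∈ Finset.range (j + 1),
      ∑ u : Fˣ, (u : F) ^ (k + (Fintype.card F - 1 - l)) = if k = l then -1 else 0 := by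
    intro k hk
    rw [Finset.mem_range] at hk
    have h := FiniteField.sum_pow_units F (k + (Fintype.card F - 1 - l))
    rw [h]
    refine if_congr ⟨?_, ?_⟩ rfl rfl
    · rintro ⟨c, hc⟩
      have hc1 : c = 1 := by
        have h0 : c ≠ 0 := by rintro rfl; omega
        have h2 : c < 2 := by
          by_contra! h
          have := Nat.mul_le_mul_left (Fintype.card F - 1) h
          omega
        omega
      subst hc1
      omega
    · rintro rfl
      rw [Nat.add_sub_cancel' (by omega)]
  rw [Finset.sum_congr rfl fun k hk => by rw [hsum k hk]]
  obtain ⟨m, rfl⟩ : ∃ m, l = m + 1 := ⟨l - 1, by omega⟩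
  simp only [mul_ite, mul_zero, Finset.sum_ite_eq', Finset.mem_range, Nat.add_sub_cancel]
  split_ifs with h
  · ring
  · rw [Nat.choose_eq_zero_of_lt (by omega)]
    simp

/-- Lemma 9.2 (`binomsum`) of Li–Meemark: for a finite field `F` with `q` elements and
characteristic `p`, a generator `a` of `F^×`, and integers `1 ≤ j ≤ q - 1`,
`1 ≤ l ≤ q - 2`, one has `Σ_{n=1}^{q-2} a^{jn} (1 - a^n)^{-l} = (-1)^{l-1} binom(j,l)`
in `F`. -/
theorem stmt_1 (F : Type*) [Field F] [Fintype F] (q p : ℕ) (hq : Fintype.card F = q)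
    (hp : CharP F p) (a : Fˣ) (ha : ∀ x : Fˣ, x ∈ Subgroup.zpowers a)
    (j l : ℕ) (hj1 : 1 ≤ j) (hj2 : j ≤ q - 1) (hl1 : 1 ≤ l) (hl2 : l ≤ q - 2) :
    ∑ n ∈ Finset.Icc 1 (q - 2), (a : F) ^ (j * n) * ((1 - (a : F) ^ n)⁻¹) ^ l =
      (-1) ^ (l - 1) * (j.choose l : F) := by
  classical
  subst hq
  have hcard : Fintype.card Fˣ = Fintype.card F - 2 + 1 := by
    rw [Fintype.card_units]
    omega
  let f : F → F := fun x => x ^ j * ((1 - x)⁻¹) ^ l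
  have hf0 : f 0 = 0 := by simp [f, show j ≠ 0 by omega]
  have hf1 : f 1 = 0 := by simp [f, show l ≠ 0 by omega]
  have hIcc : Finset.Icc 1 (Fintype.card F - 2) = Finset.Ico (0 + 1) (Fintype.card F - 2 + 1) := by
    ext
    simp
  calc
    _ = ∑ n ∈ Finset.Ico (0 + 1) (Fintype.card F - 2 + 1), f ((a ^ n : Fˣ) : F) := by
      rw [hIcc]
      refine Finset.sum_congr rfl fun n _ => ?_
      simp only [f, Units.val_pow_eq_pow_val, mul_comm j n, pow_mul]
    _ = ∑ n ∈ Finset.range (Fintype.card Fˣ), f ((a ^ n : Fˣ) : F) := by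
      rw [hcard, Finset.sum_range_succ', pow_zero, Units.val_one, hf1, add_zero,
        Finset.range_eq_Ico, Finset.sum_Ico_add' (fun n => f ((a ^ n : Fˣ) : F))]
    _ = ∑ x, f x := by
      rw [← sum_eq_sum_range_pow a ha (fun u => f u), ← sum_eq_sum_units_of_zero f hf0]
    _ = ∑ x, (1 - x) ^ j * (x⁻¹) ^ l := by
      rw [← Equiv.sum_comp (Equiv.subLeft (1 : F))]
      simp only [f, Equiv.subLeft_apply, sub_sub_cancel]
    _ = _ := by
      rw [sum_eq_sum_units_of_zero _ (by simp [show l ≠ 0 by omega]),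
        sum_units_one_sub_pow_mul_inv_pow j l hj2 hl1 hl2]
end

section
/- Let F be a finite field with q ≥ 3 elements and characteristic p, and let a be a generator of the cyclic group F^× of units. For every integer j with 1 ≤ j ≤ q-1, one has Σ_{n=1}^{q-2} a^{jn} · (1 - a^n)^{-1} = j·1_F in F, where j·1_F denotes the image of the integer j in F. -/
open Finset

/-- Summing a function over the powers `1, a, …, a ^ (m - 1)` of a generator `a` of a finite cyclic
group of order `m` is summing it over the group. -/
theorem sum_range_card_generator_pow {G M : Type*} [Group G] [Fintype G] [AddCommMonoid M]
    {a : G} (ha : ∀ x : G, x ∈ Subgroup.zpowers a) (f : G → M) :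
    ∑ n ∈ range (Fintype.card G), f (a ^ n) = ∑ x, f x := by
  classical
  rw [← Nat.card_eq_fintype_card, ← IsCyclic.image_range_card ha, sum_image]
  rw [← orderOf_eq_card_of_forall_mem_zpowers ha, coe_range]
  exact pow_injOn_Iio_orderOf

theorem sum_mul_inv_one_sub {F : Type*} [Field F] [Fintype F] (h : 3 ≤ Fintype.card F) :
    ∑ x : F, x * (1 - x)⁻¹ = 1 := by
  classical
  have hinv : ∑ x : F, x⁻¹ = 0 := by
    refine (Equiv.sum_comp (Equiv.inv F) fun x => x).trans ?_
    simpa using FiniteField.sum_pow_lt_card_sub_one F 1 (by omega)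
  have hterm (x : F) : (1 - x) * (1 - (1 - x))⁻¹ = x⁻¹ - (1 - if x = 0 then 1 else 0) := by
    by_cases hx : x = 0
    · simp [hx]
    · simp [hx, sub_mul]
  rw [← Equiv.sum_comp (Equiv.subLeft (1 : F))]
  simp only [Equiv.subLeft_apply, hterm]
  simp [sum_sub_distrib, hinv]

theorem sum_pow_mul_inv_one_sub {F : Type*} [Field F] [Fintype F] (h : 3 ≤ Fintype.card F)
    {j : ℕ} (hj1 : 1 ≤ j) (hj2 : j ≤ Fintype.card F - 1) :
    ∑ x : F, x ^ j * (1 - x)⁻¹ = j := by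
  classical
  induction j, hj1 using Nat.le_induction with
  | base => simpa using sum_mul_inv_one_sub h
  | succ j hj ih =>
    have hterm (x : F) :
        x ^ (j + 1) * (1 - x)⁻¹ = x ^ j * (1 - x)⁻¹ - (x ^ j - if x = 1 then 1 else 0) := by
      by_cases hx : x = 1
      · simp [hx]
      · have : 1 - x ≠ 0 := sub_ne_zero.mpr (Ne.symm hx)
        simp only [hx, if_false]
        field_simp
        ring
    simp [hterm, sum_sub_distrib, ih (by omega),
      FiniteField.sum_pow_lt_card_sub_one F j (by omega)]

/-- The `l = 1` case of Lemma 9.2 of Li–Meemark: for a finite field `F` with `q ≥ 3`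
elements and characteristic `p`, a generator `a` of `F^×`, and `1 ≤ j ≤ q - 1`,
one has `Σ_{n=1}^{q-2} a^{jn} (1 - a^n)^{-1} = j · 1_F` in `F`. -/
theorem stmt_2 (F : Type*) [Field F] [Fintype F] (q p : ℕ) (hq : Fintype.card F = q)
    (hq3 : 3 ≤ q) (hp : CharP F p) (a : Fˣ) (ha : ∀ x : Fˣ, x ∈ Subgroup.zpowers a)
    (j : ℕ) (hj1 : 1 ≤ j) (hj2 : j ≤ q - 1) :
    ∑ n ∈ Finset.Icc 1 (q - 2), (a : F) ^ (j * n) * (1 - (a : F) ^ n)⁻¹ = (j : F) := by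
  classical
  subst hq
  have hcard : Fintype.card Fˣ = Fintype.card F - 2 + 1 := by
    rw [Fintype.card_units]
    omega
  have hunits := sum_range_card_generator_pow ha fun x : Fˣ => (x : F) ^ j * (1 - (x : F))⁻¹
  have hfield := sum_pow_mul_inv_one_sub hq3 hj1 hj2
  rw [hcard, sum_range_succ', pow_zero, Units.val_one, sub_self, inv_zero, mul_zero, add_zero]
    at hunits
  rw [Fintype.sum_eq_add_sum_subtype_ne _ (0 : F), zero_pow (by omega), zero_mul, zero_add,
    ← Equiv.sum_comp unitsEquivNeZero] at hfield
  refine Eq.trans ?_ (hunits.trans hfield)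
  rw [range_eq_Ico, sum_Ico_add' (fun n => ((a ^ n : Fˣ) : F) ^ j *
    (1 - ((a ^ n : Fˣ) : F))⁻¹)]
  refine sum_congr rfl fun n _ => ?_
  rw [Units.val_pow_eq_pow_val, ← pow_mul, mul_comm n]
end

section
/- Let F be a finite field with q ≥ 3 elements and characteristic p, and let a be a generator of F^×. Let C' be the (q-1)×(q-1) matrix over F with rows and columns indexed by residues i, n ∈ Z/(q-1), defined by C'(i,n) = (1 - a^{n-i})^{-1} for n ≠ i and C'(i,i) = 0 (the exponent n-i taken modulo q-1). Then for every integer j with 1 ≤ j ≤ q-1, the vector v_j with entries v_j(n) = a^{nj} satisfies C' · v_j = (j·1_F) · v_j; that is, v_j is an eigenvector of C' with eigenvalue the image of j in F. In particular C' has q-1 linearly independent eigenvectors v_1, …, v_{q-1}. -/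
open Finset Matrix

/-- Over a finite field, `∑ x ^ j / (1 - x) = j` for `j < q`, with the convention `0⁻¹ = 0`. -/
theorem FiniteField.sum_pow_mul_one_sub_inv (F : Type*) [Field F] [Fintype F]
    (hF : 3 ≤ Fintype.card F) (j : ℕ) (hj : j ≤ Fintype.card F - 1) :
    ∑ x : F, x ^ j * (1 - x)⁻¹ = j := by
  classical
  induction j with
  | zero =>
    have h1 : ∑ x : F, (1 - x)⁻¹ = ∑ x : F, x :=
      Fintype.sum_bijective (fun x : F => (1 - x)⁻¹)
        (inv_involutive.bijective.comp (Equiv.subLeft (1 : F)).bijective) _ _ fun _ => rfl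
    have h2 := FiniteField.sum_pow_lt_card_sub_one F 1 (by omega)
    simp only [pow_one] at h2
    simp [h1, h2]
  | succ k ih =>
    have hk := ih (by omega)
    have h2 := FiniteField.sum_pow_lt_card_sub_one F k (by omega)
    have key : ∀ x : F, x ^ (k + 1) * (1 - x)⁻¹ =
        x ^ k * (1 - x)⁻¹ - x ^ k + if x = 1 then 1 else 0 := by
      intro x
      split_ifs with hx
      · simp [hx]
      · have : 1 - x ≠ 0 := sub_ne_zero.mpr (Ne.symm hx)
        field_simp
        ring
    simp only [key, sum_add_distrib, sum_sub_distrib, hk, h2]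
    simp

/-- If `a` has order `m`, then `n ↦ a ^ n.val` is additive-to-multiplicative on `ZMod m`. -/
theorem pow_val_add_of_orderOf_eq {G : Type*} [Monoid G] {m : ℕ} [NeZero m] {a : G}
    (ha : orderOf a = m) (x y : ZMod m) : a ^ (x + y).val = a ^ x.val * a ^ y.val := by
  subst ha
  rw [ZMod.val_add, pow_mod_orderOf, pow_add]

/-- If `a` has order `m`, then `n ↦ a ^ n.val` is injective on `ZMod m`. -/
theorem pow_val_injective_of_orderOf_eq {G : Type*} [Monoid G] {m : ℕ} [NeZero m] {a : G}
    (ha : orderOf a = m) : Function.Injective fun n : ZMod m => a ^ n.val := by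
  subst ha
  intro x y h
  exact ZMod.val_injective _
    (pow_injOn_Iio_orderOf (ZMod.val_lt x) (ZMod.val_lt y) h)

/-- The circulant matrix `C'` with entries `C'(i,n) = (1 - a^{n-i})⁻¹` for `n ≠ i` and
zero diagonal (indices in `ℤ/(q-1)`), arising in the weight-3 analysis for `Γ(T)`,
has for each `1 ≤ j ≤ q-1` the eigenvector `v_j(n) = a^{nj}` with eigenvalue the image
of `j` in `F`; moreover `v_1, …, v_{q-1}` are linearly independent. -/
theorem stmt_4 (F : Type*) [Field F] [Fintype F] (q p : ℕ) (hq : Fintype.card F = q)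
    (hq3 : 3 ≤ q) (hp : CharP F p) [NeZero (q - 1)]
    (a : Fˣ) (ha : ∀ x : Fˣ, x ∈ Subgroup.zpowers a) :
    (∀ j : ℕ, 1 ≤ j → j ≤ q - 1 →
      (Matrix.of fun i n : ZMod (q - 1) =>
          if n = i then (0 : F) else (1 - (a : F) ^ (n - i).val)⁻¹).mulVec
        (fun n : ZMod (q - 1) => (a : F) ^ (n.val * j)) =
      (j : F) • fun n : ZMod (q - 1) => (a : F) ^ (n.val * j)) ∧
    LinearIndependent F
      (fun j : Fin (q - 1) => fun n : ZMod (q - 1) => (a : F) ^ (n.val * (j.val + 1))) := by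
  classical
  have hcard : Fintype.card Fˣ = q - 1 := by rw [Fintype.card_units, hq]
  have hord : orderOf a = q - 1 := by
    rw [orderOf_eq_card_of_forall_mem_zpowers ha, Nat.card_eq_fintype_card, hcard]
  have hordF : orderOf (a : F) = q - 1 := by rw [orderOf_units, hord]
  constructor
  · intro j hj1 hj
    ext i
    have hbij : Function.Bijective fun n : ZMod (q - 1) => a ^ n.val :=
      (Fintype.bijective_iff_injective_and_card _).mpr
        ⟨pow_val_injective_of_orderOf_eq hord, by rw [ZMod.card, hcard]⟩
    have hsum : ∑ m : ZMod (q - 1), ((a : F) ^ m.val) ^ j * (1 - (a : F) ^ m.val)⁻¹ = j := by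
      rw [← FiniteField.sum_pow_mul_one_sub_inv F (by omega) j (by omega),
        Fintype.sum_bijective _ hbij _ (fun u : Fˣ => (u : F) ^ j * (1 - (u : F))⁻¹)
          fun m => by simp]
      refine Finset.sum_of_injOn (fun u : Fˣ => (u : F)) (Units.val_injective.injOn)
        (by simp) ?_ (by simp)
      intro x _ hx
      have hx0 : x = 0 := by
        by_contra h
        exact hx ⟨Units.mk0 x h, by simp, rfl⟩
      simp [hx0, Nat.one_le_iff_ne_zero.mp hj1]
    simp only [Matrix.mulVec, dotProduct, Matrix.of_apply, Pi.smul_apply, smul_eq_mul]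
    rw [← hsum, Finset.sum_mul, ← Equiv.sum_comp (Equiv.addRight i)]
    refine Finset.sum_congr rfl fun m _ => ?_
    simp only [Equiv.coe_addRight, add_sub_cancel_right, add_eq_right]
    rw [pow_mul _ _ j, pow_val_add_of_orderOf_eq hordF, mul_pow, pow_mul _ _ j]
    split_ifs with hm
    · simp [hm]
    · ring
  · rw [Fintype.linearIndependent_iff]
    intro g hg
    refine congr_fun (Matrix.eq_zero_of_forall_index_sum_pow_mul_eq_zero
      (f := fun n : Fin (q - 1) => (a : F) ^ (n : ℕ)) ?_ ?_)
    · intro x y h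
      exact Fin.ext (pow_injOn_Iio_orderOf (by simp [hordF]) (by simp [hordF]) h)
    · intro n
      have h := congr_fun hg ((n : ℕ) : ZMod (q - 1))
      simp only [Finset.sum_apply, Pi.smul_apply, smul_eq_mul, Pi.zero_apply,
        ZMod.val_cast_of_lt n.isLt] at h
      refine (mul_eq_zero_iff_left (pow_ne_zero (n : ℕ) a.ne_zero)).mp ?_
      rw [Finset.mul_sum, ← h]
      refine Finset.sum_congr rfl fun j _ => ?_
      rw [pow_mul, pow_succ]
      ring
end

section
/- Let F be a finite field with q ≥ 3 elements and characteristic p. Let M be the q×q matrix over F whose rows and columns are indexed by the elements of F, with entries M(r,b) = (r-b)^{-1} for r ≠ b and M(r,r) = 0. Then the kernel of M (as an F-linear map F^F → F^F) has dimension q/p. Moreover, the kernel is spanned by the all-ones vector together with the vectors w_j (for integers j with 1 ≤ j ≤ q-1 and p dividing j) defined by w_j(0) = 0 and w_j(b) = b^j for b ≠ 0. -/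
open Finset Matrix

/-- On a finite field, the power functions of exponent less than `q` are linearly independent. -/
theorem linearIndependent_pow_fun (F : Type*) [Field F] [Fintype F] :
    LinearIndependent F (fun (j : Fin (Fintype.card F)) (b : F) => b ^ (j : ℕ)) := by
  rw [Fintype.linearIndependent_iff]
  intro g hg i
  have hP : ∑ j : Fin (Fintype.card F), Polynomial.monomial (j : ℕ) (g j) = 0 := by
    refine Polynomial.eq_zero_of_degree_lt_of_eval_finset_eq_zero Finset.univ ?_ ?_
    · rw [Finset.card_univ]
      refine (Polynomial.degree_sum_le _ _).trans_lt ?_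
      rw [Finset.sup_lt_iff (WithBot.bot_lt_coe _)]
      intro j _
      exact (Polynomial.degree_monomial_le _ _).trans_lt (by exact_mod_cast j.2)
    · intro b _
      simpa [Polynomial.eval_finsetSum] using congrFun hg b
  have := congrArg (fun P => Polynomial.coeff P (i : ℕ)) hP
  simpa [Polynomial.finsetSum_coeff, Polynomial.coeff_monomial, Fin.val_inj] using this

/-- Convolution with `c ↦ c ^ (q - 2)` acts on power functions of exponent less than `q`
as differentiation. -/
theorem sum_sub_pow_mul_pow (F : Type*) [Field F] [Fintype F] (hq : 3 ≤ Fintype.card F)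
    {j : ℕ} (hj : j < Fintype.card F) (r : F) :
    ∑ b : F, (r - b) ^ (Fintype.card F - 2) * b ^ j = j * r ^ (j - 1) := by
  classical
  have hterm (c : F) : c ^ (Fintype.card F - 2) * (r - c) ^ j =
      ∑ i ∈ range (j + 1),
        ((-1) ^ i * r ^ (j - i) * (j.choose i : F)) * c ^ (Fintype.card F - 2 + i) := by
    rw [sub_eq_neg_add, add_pow, mul_sum]
    refine sum_congr rfl fun i _ => ?_
    rw [neg_pow, pow_add]
    ring
  have hsum (i : ℕ) (hi : i ≤ j) :
      ∑ c : F, c ^ (Fintype.card F - 2 + i) = if i = 1 then -1 else 0 := by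
    have hdvd : Fintype.card F - 1 ∣ Fintype.card F - 2 + i ↔ i = 1 := by
      constructor
      · rintro ⟨k, hk⟩
        have h1 : 0 < k := by
          rcases Nat.eq_zero_or_pos k with rfl | h
          · omega
          · exact h
        have h2 : k < 2 := by
          by_contra! h
          have := Nat.mul_le_mul_left (Fintype.card F - 1) h
          omega
        obtain rfl : k = 1 := by omega
        omega
      · rintro rfl
        exact ⟨1, by omega⟩
    let φ : Fˣ ↪ F := ⟨fun x => x, Units.val_injective⟩
    have hφ : univ.map φ = univ \ {0} := by
      ext x
      simpa only [mem_map, mem_univ, Function.Embedding.coeFn_mk, true_and, mem_sdiff,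
        mem_singleton, φ] using! isUnit_iff_ne_zero
    rw [← sum_sdiff (subset_univ ({0} : Finset F)), sum_singleton, zero_pow (by omega), add_zero,
      ← hφ, sum_map]
    exact (FiniteField.sum_pow_units F _).trans (if_congr hdvd rfl rfl)
  rw [← Equiv.sum_comp (Equiv.subLeft r)]
  simp only [Equiv.subLeft_apply, sub_sub_cancel, hterm]
  rw [sum_comm]
  simp only [← mul_sum]
  rw [sum_congr rfl fun i hi => by rw [hsum i (by simpa [Nat.lt_succ_iff] using hi)]]
  simp only [mul_ite, mul_zero, sum_ite_eq', mem_range]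
  rcases Nat.eq_zero_or_pos j with rfl | h
  · simp
  · rw [if_pos (by omega)]
    simp [mul_comm]

/-- For a finite field `F` with `q ≥ 3` elements and characteristic `p`, the `q × q`
matrix `M` with entries `M(r,b) = (r-b)⁻¹` for `r ≠ b` and zero diagonal has kernel of
dimension `q/p`, spanned by the all-ones vector together with the vectors
`w_j(b) = b^j` (with `w_j(0) = 0`) for `1 ≤ j ≤ q-1` with `p ∣ j`. -/
theorem stmt_5 (F : Type*) [Field F] [Fintype F] [DecidableEq F] (q p : ℕ)
    (hq : Fintype.card F = q) (hq3 : 3 ≤ q) (hp : CharP F p)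
    (M : Matrix F F F) (hM : ∀ r b : F, M r b = if r = b then 0 else (r - b)⁻¹) :
    Module.finrank F (LinearMap.ker M.mulVecLin) = q / p ∧
    LinearMap.ker M.mulVecLin =
      Submodule.span F
        ({fun _ : F => (1 : F)} ∪
          {w : F → F | ∃ j : ℕ, 1 ≤ j ∧ j ≤ q - 1 ∧ p ∣ j ∧
            w = fun b : F => if b = 0 then 0 else b ^ j}) := by
  subst hq
  have hpq : p ∣ Fintype.card F := (CharP.cast_eq_zero_iff F p _).1 (Nat.cast_card_eq_zero F)
  have hp0 : 0 < p := Nat.pos_of_dvd_of_pos hpq (by omega)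
  have hlt (i : Fin (Fintype.card F / p)) : p * i < Fintype.card F := by
    have := Nat.mul_lt_mul_of_pos_left i.2 hp0
    rwa [Nat.mul_div_cancel' hpq] at this
  have hli := linearIndependent_pow_fun F
  have hM' (r b : F) : M r b = (r - b) ^ (Fintype.card F - 2) := by
    rw [hM]
    split_ifs with h
    · rw [h, sub_self, zero_pow (by omega)]
    · have h0 := sub_ne_zero.2 h
      refine inv_eq_of_mul_eq_one_right ?_
      rw [← pow_succ', show Fintype.card F - 2 + 1 = Fintype.card F - 1 by omega,
        FiniteField.pow_card_sub_one_eq_one _ h0]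
  have hpow {j : ℕ} (hj : j < Fintype.card F) :
      M.mulVecLin (fun b => b ^ j) = (j : F) • fun b => b ^ (j - 1) := by
    ext r
    simp only [mulVecLin_apply, mulVec, dotProduct, hM', sum_sub_pow_mul_pow F hq3 hj,
      Pi.smul_apply, smul_eq_mul]
  have hset : ({fun _ : F => (1 : F)} ∪
          {w : F → F | ∃ j : ℕ, 1 ≤ j ∧ j ≤ Fintype.card F - 1 ∧ p ∣ j ∧
            w = fun b : F => if b = 0 then 0 else b ^ j}) =
      Set.range fun (i : Fin (Fintype.card F / p)) (b : F) => b ^ (p * (i : ℕ)) := by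
    have hw {j : ℕ} (hj : 1 ≤ j) :
        (fun b : F => if b = 0 then 0 else b ^ j) = fun b => b ^ j := by
      ext b
      split_ifs with h
      · rw [h, zero_pow (by omega)]
      · rfl
    ext w
    constructor
    · rintro (rfl | ⟨j, h1, h2, ⟨k, rfl⟩, rfl⟩)
      · exact ⟨⟨0, Nat.div_pos (Nat.le_of_dvd (by omega) hpq) hp0⟩, by simp⟩
      · rw [hw h1]
        refine ⟨⟨k, ?_⟩, rfl⟩
        rw [Nat.lt_div_iff_mul_lt' hpq]
        omega
    · rintro ⟨i, rfl⟩
      rcases Nat.eq_zero_or_pos (p * (i : ℕ)) with h | h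
      · left
        simp [h]
      · right
        exact ⟨p * i, h, by have := hlt i; omega, dvd_mul_right _ _, (hw h).symm⟩
  have hker : LinearMap.ker M.mulVecLin = Submodule.span F
      (Set.range fun (i : Fin (Fintype.card F / p)) (b : F) => b ^ (p * (i : ℕ))) := by
    apply le_antisymm
    · intro x hx
      have hspan : x ∈ Submodule.span F
          (Set.range fun (j : Fin (Fintype.card F)) (b : F) => b ^ (j : ℕ)) := by
        rw [hli.span_eq_top_of_card_eq_finrank' (by simp)]
        trivial
      obtain ⟨c, rfl⟩ := (Submodule.mem_span_range_iff_exists_fun F).1 hspan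
      have hder : ∑ j : Fin (Fintype.card F), (c j * ((j : ℕ) : F)) •
          (fun b : F => b ^ ((j : ℕ) - 1)) = 0 := by
        rw [LinearMap.mem_ker, map_sum] at hx
        rw [← hx]
        refine sum_congr rfl fun j _ => ?_
        rw [map_smul, hpow j.2, smul_smul]
      have hc (j : Fin (Fintype.card F)) : c j * ((j : ℕ) : F) = 0 := by
        rcases Nat.eq_zero_or_pos (j : ℕ) with h | h
        · simp [h]
        have hli' : LinearIndependent F (fun (j : {j : Fin (Fintype.card F) // 0 < (j : ℕ)})
            (b : F) => b ^ ((j : Fin (Fintype.card F)) - 1 : ℕ)) :=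
          hli.comp (fun j : {j : Fin (Fintype.card F) // 0 < (j : ℕ)} =>
              ⟨(j : Fin (Fintype.card F)) - 1, by omega⟩) fun a b hab => by
            have h1 := a.2
            have h2 := b.2
            have h3 := Fin.val_eq_of_eq hab
            apply Subtype.ext
            apply Fin.ext
            simp only at h3
            omega
        refine Fintype.linearIndependent_iff.1 hli'
          (fun j => c j * (((j : Fin (Fintype.card F)) : ℕ) : F)) ?_ ⟨j, h⟩
        rw [← hder, ← Fintype.sum_subtype_add_sum_subtype
          (fun j : Fin (Fintype.card F) => 0 < (j : ℕ)), left_eq_add]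
        refine sum_eq_zero fun i _ => ?_
        rw [Nat.eq_zero_of_not_pos i.2, Nat.cast_zero, mul_zero, zero_smul]
      refine Submodule.sum_mem _ fun j _ => ?_
      rcases mul_eq_zero.1 (hc j) with h | h
      · rw [h, zero_smul]
        exact Submodule.zero_mem _
      · obtain ⟨k, hk⟩ := (CharP.cast_eq_zero_iff F p _).1 h
        refine Submodule.smul_mem _ _ (Submodule.subset_span ⟨⟨k, ?_⟩, by simp only [hk]⟩)
        rw [Nat.lt_div_iff_mul_lt' hpq, ← hk]
        exact j.2
    · rw [Submodule.span_le]
      rintro _ ⟨i, rfl⟩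
      rw [SetLike.mem_coe, LinearMap.mem_ker, hpow (hlt i)]
      simp
  refine ⟨?_, hker.trans (by rw [hset])⟩
  rw [hker, finrank_span_eq_card, Fintype.card_fin]
  exact hli.comp (fun i : Fin (Fintype.card F / p) => ⟨p * i, hlt i⟩) fun a b hab =>
    Fin.ext (Nat.eq_of_mul_eq_mul_left hp0 (Fin.val_eq_of_eq hab))
end

section
/- Let F be a finite field with q ≥ 5 elements and odd characteristic p. Let N be the q×q matrix over F whose rows and columns are indexed by the elements of F, with entries N(r,b) = (r-b)^{-3} for r ≠ b and N(r,r) = 0. Then the kernel of N has dimension 3q/p if p > 3, and dimension q/p if p = 3. -/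
open Finset Matrix

/-- The number of `k < m` such that `n.choose k` is not divisible by `p`. -/
def countChooseNotDvd (p n m : ℕ) : ℕ := #{k ∈ range m | ¬ p ∣ n.choose k}

theorem countChooseNotDvd_of_lt {p a : ℕ} (hp : p.Prime) (ha : a < p) :
    countChooseNotDvd p a p = a + 1 := by
  have h : {k ∈ range p | ¬ p ∣ a.choose k} = range (a + 1) := by
    ext k
    simp only [mem_filter, mem_range]
    constructor
    · rintro ⟨-, h⟩
      by_contra hk
      exact h (by rw [Nat.choose_eq_zero_of_lt (by omega)]; exact dvd_zero p)
    · intro hk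
      refine ⟨by omega, fun h => ?_⟩
      have hd : p ∣ a.factorial := by
        rw [← Nat.choose_mul_factorial_mul_factorial (show k ≤ a by omega), mul_assoc]
        exact h.mul_right _
      exact absurd ((hp.dvd_factorial).1 hd) (by omega)
  rw [countChooseNotDvd, h, card_range]

theorem not_dvd_choose_prime_pow_sub_one {p : ℕ} (hp : p.Prime) (m k : ℕ) (hk : k < p ^ m) :
    ¬ p ∣ (p ^ m - 1).choose k := by
  induction k with
  | zero => simpa using hp.one_lt.ne'
  | succ k ih =>
    intro h
    refine ih (by omega) ((Nat.dvd_add_left h).1 ?_)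
    rw [← Nat.choose_succ_succ, Nat.succ_eq_add_one, Nat.sub_add_cancel (by omega)]
    exact hp.dvd_choose_pow (by omega) (by omega)

theorem countChooseNotDvd_prime_pow_sub_one {p : ℕ} (hp : p.Prime) (m : ℕ) :
    countChooseNotDvd p (p ^ m - 1) (p ^ m) = p ^ m := by
  rw [countChooseNotDvd, filter_true_of_mem, card_range]
  exact fun k hk => not_dvd_choose_prime_pow_sub_one hp m k (mem_range.1 hk)

theorem countChooseNotDvd_add_mul {p a : ℕ} (hp : p.Prime) (ha : a < p) (b m : ℕ) :
    countChooseNotDvd p (a + p * b) (p * m) =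
      countChooseNotDvd p a p * countChooseNotDvd p b m := by
  have := Fact.mk hp
  have key (k : ℕ) : p ∣ (a + p * b).choose k ↔ p ∣ a.choose (k % p) ∨ p ∣ b.choose (k / p) := by
    have h := Choose.choose_modEq_choose_mod_mul_choose_div_nat (n := a + p * b) (k := k) (p := p)
    rw [Nat.add_mul_mod_self_left, Nat.mod_eq_of_lt ha, Nat.add_mul_div_left _ _ hp.pos,
      Nat.div_eq_of_lt ha, zero_add] at h
    rw [← hp.dvd_mul]
    exact h.dvd_iff dvd_rfl
  unfold countChooseNotDvd
  rw [← card_product]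
  refine card_nbij' (fun k => (k % p, k / p)) (fun x => x.1 + p * x.2) ?_ ?_ ?_ ?_
  · intro k hk
    simp only [coe_filter, mem_range, Set.mem_ofPred_eq, key, not_or] at hk
    simpa [Nat.mod_lt _ hp.pos, Nat.div_lt_iff_lt_mul hp.pos, mul_comm m p, hk.1] using hk.2
  · rintro ⟨i, j⟩ hx
    simp only [coe_product, coe_filter, mem_range, Set.mem_prod, Set.mem_ofPred_eq] at hx
    obtain ⟨⟨hi, hi'⟩, hj, hj'⟩ := hx
    simp only [coe_filter, mem_range, Set.mem_ofPred_eq, key, not_or, Nat.add_mul_mod_self_left,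
      Nat.mod_eq_of_lt hi, Nat.add_mul_div_left _ _ hp.pos, Nat.div_eq_of_lt hi, zero_add]
    exact ⟨by nlinarith, hi', hj'⟩
  · intro k _
    exact Nat.mod_add_div k p
  · rintro ⟨i, j⟩ hx
    simp only [coe_product, coe_filter, mem_range, Set.mem_prod, Set.mem_ofPred_eq] at hx
    simp [Nat.mod_eq_of_lt hx.1.1, Nat.add_mul_div_left _ _ hp.pos, Nat.div_eq_of_lt hx.1.1]

/-- Over a field with `q` elements, the matrix `((r - b) ^ n)` with `n < q` has rank the number
of nonzero binomial coefficients in the expansion of `(r - b) ^ n`. -/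
theorem rank_of_sub_pow {F : Type*} [Field F] [Fintype F] [DecidableEq F] (p : ℕ) [CharP F p]
    {n : ℕ} (hn : n < Fintype.card F) :
    (Matrix.of fun r b : F => (r - b) ^ n).rank = countChooseNotDvd p n (Fintype.card F) := by
  set q := Fintype.card F with hq
  have : NeZero q := ⟨by omega⟩
  let e : Fin q ≃ F := (Fintype.equivFin F).symm
  let a : Fin q := ⟨n, hn⟩
  let V := vandermonde (e : Fin q → F)
  let W := (vandermonde fun i => -e i)ᵀ.submatrix (Equiv.subLeft a) id
  let c : Fin q → F := fun k => (n.choose k : F)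
  have hV : IsUnit V.det := (det_vandermonde_ne_zero_iff.2 e.injective).isUnit
  have hW : IsUnit W.det := by
    rw [det_permute, det_transpose]
    exact ((Equiv.Perm.sign _).isUnit.map (Int.castRingHom F)).mul
      (det_vandermonde_ne_zero_iff.2 (neg_injective.comp e.injective)).isUnit
  have hfac : (Matrix.of fun r b : F => (r - b) ^ n).submatrix e e = V * diagonal c * W := by
    ext i j
    have hterm (k : Fin q) : V i k * c k * W k j =
        e i ^ (k : ℕ) * (-e j) ^ (n - k) * (n.choose k : F) := by
      change e i ^ (k : ℕ) * (n.choose k : F) * (-e j) ^ ((a - k : Fin q) : ℕ) = _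
      rcases le_or_gt (k : ℕ) n with hk | hk
      · rw [Fin.sub_val_of_le (show k ≤ a from hk)]
        ring
      · simp [Nat.choose_eq_zero_of_lt hk]
    rw [mul_apply]
    simp only [mul_diagonal, hterm]
    rw [Fin.sum_univ_eq_sum_range (fun k => e i ^ k * (-e j) ^ (n - k) * (n.choose k : F)) q,
      submatrix_apply, of_apply, sub_eq_add_neg, add_pow]
    refine sum_subset (range_subset_range.2 hn) fun k _ hk => ?_
    rw [Nat.choose_eq_zero_of_lt (by simpa using hk), Nat.cast_zero, mul_zero]
  rw [← rank_submatrix _ e e, hfac, rank_mul_eq_left_of_isUnit_det _ _ hW,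
    rank_mul_eq_right_of_isUnit_det _ _ hV, rank_diagonal, Fintype.card_subtype,
    countChooseNotDvd, card_filter, card_filter, ← Fin.sum_univ_eq_sum_range]
  simp only [c, ne_eq, CharP.cast_eq_zero_iff F p]

theorem inv_pow_three_eq_pow {F : Type*} [Field F] [Fintype F] (h : 5 ≤ Fintype.card F) {x : F}
    (hx : x ≠ 0) : x⁻¹ ^ 3 = x ^ (Fintype.card F - 4) := by
  rw [inv_pow]
  refine inv_eq_of_mul_eq_one_right ?_
  rw [← pow_add,
    show 3 + (Fintype.card F - 4) = Fintype.card F - 1 by omega,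
    FiniteField.pow_card_sub_one_eq_one x hx]

/-- For a finite field `F` with `q ≥ 5` elements and odd characteristic `p`, the `q × q`
matrix `N` with entries `N(r,b) = (r-b)⁻³` for `r ≠ b` and zero diagonal has kernel of
dimension `3q/p` if `p > 3`, and dimension `q/p` if `p = 3`. -/
theorem stmt_7 (F : Type*) [Field F] [Fintype F] [DecidableEq F] (q p : ℕ)
    (hq : Fintype.card F = q) (hq5 : 5 ≤ q) (hp : CharP F p) (hodd : Odd p)
    (N : Matrix F F F)
    (hN : ∀ r b : F, N r b = if r = b then 0 else ((r - b)⁻¹) ^ 3) :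
    (3 < p → Module.finrank F (LinearMap.ker N.mulVecLin) = 3 * q / p) ∧
    (p = 3 → Module.finrank F (LinearMap.ker N.mulVecLin) = q / p) := by
  have hNpow : N = Matrix.of fun r b : F => (r - b) ^ (q - 4) := by
    ext r b
    rw [hN, of_apply]
    split_ifs with h
    · rw [h, sub_self, zero_pow (by omega)]
    · rw [inv_pow_three_eq_pow (hq ▸ hq5) (sub_ne_zero.2 h), hq]
  have hrank : N.rank = countChooseNotDvd p (q - 4) q := by
    subst hq
    rw [hNpow, rank_of_sub_pow p (by omega)]
  have hnull : N.rank + Module.finrank F (LinearMap.ker N.mulVecLin) = q := by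
    rw [rank, LinearMap.finrank_range_add_finrank_ker, Module.finrank_fintype_fun_eq_card, hq]
  obtain ⟨n, hpr, hcard⟩ := FiniteField.card F p
  obtain ⟨m, hm⟩ : ∃ m, (n : ℕ) = m + 1 := ⟨n - 1, by have := n.pos; omega⟩
  have hqm : q = p * p ^ m := by rw [← hq, hcard, hm, pow_succ']
  have hpos (k : ℕ) : 0 < p ^ k := pow_pos hpr.pos k
  constructor
  · intro h3
    have h4 : p ≠ 4 := by rintro rfl; revert hodd; decide
    have hexp : q - 4 = (p - 4) + p * (p ^ m - 1) := by
      have := hpos m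
      have := Nat.le_mul_of_pos_right p this
      rw [hqm, Nat.mul_sub]
      omega
    rw [hrank, hexp, hqm, countChooseNotDvd_add_mul hpr (by omega),
      countChooseNotDvd_of_lt hpr (by omega), countChooseNotDvd_prime_pow_sub_one hpr,
      show p - 4 + 1 = p - 3 by omega, Nat.sub_mul] at hnull
    have := Nat.mul_le_mul_right (p ^ m) h3.le
    rw [hqm, show 3 * (p * p ^ m) = p * (3 * p ^ m) by ring, Nat.mul_div_cancel_left _ hpr.pos]
    omega
  · rintro rfl
    obtain ⟨l, rfl⟩ : ∃ l, m = l + 1 :=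
      Nat.exists_eq_succ_of_ne_zero (by rintro rfl; omega)
    have := hpos l
    have hexp : q - 4 = 2 + 3 * (1 + 3 * (3 ^ l - 1)) := by
      rw [hqm, pow_succ]
      omega
    rw [hrank, hexp, hqm, countChooseNotDvd_add_mul hpr (by omega), pow_succ',
      countChooseNotDvd_add_mul hpr (by omega), countChooseNotDvd_of_lt hpr (by omega),
      countChooseNotDvd_of_lt hpr (by omega), countChooseNotDvd_prime_pow_sub_one hpr] at hnull
    rw [hqm, pow_succ']
    omega
end

section
/- Let F be a finite field with q elements, A = F[T] the polynomial ring, K = F(T) its fraction field, and let Γ(T) be the subgroup of GL_2(A) consisting of matrices congruent to the identity modulo T. Let P ∈ A be an irreducible polynomial of degree d ≥ 1 with constant term P(0) = 1. Then, inside GL_2(K), the double coset Γ(T)·diag(P,1)·Γ(T) is the union of the left cosets Γ(T)·[[P,0],[0,1]] and Γ(T)·[[1, b(1-P)],[0,P]] for b ∈ A with deg b < d (including b = 0), and these q^d + 1 left cosets are pairwise disjoint. -/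
open Matrix Polynomial

/-- The congruence subgroup `Γ(T)` of `GL₂(F[T])`, viewed as a set of `2 × 2` matrices
over the rational function field `K = F(T)`: matrices with polynomial entries, determinant
a unit of `F[T]`, congruent to the identity modulo `T`. -/
def GammaT (F : Type*) [Field F] : Set (Matrix (Fin 2) (Fin 2) (RatFunc F)) :=
  {M | ∃ g : Matrix (Fin 2) (Fin 2) (Polynomial F),
    IsUnit g.det ∧
    g.map (algebraMap (Polynomial F) (RatFunc F)) = M ∧
    Polynomial.X ∣ (g 0 0 - 1) ∧ Polynomial.X ∣ (g 1 1 - 1) ∧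
    Polynomial.X ∣ g 0 1 ∧ Polynomial.X ∣ g 1 0}

/-- The left coset `Γ(T) · g` inside the `2 × 2` matrices over `K = F(T)`, where `g` is a
matrix with polynomial entries. -/
def leftCoset' (F : Type*) [Field F] (g : Matrix (Fin 2) (Fin 2) (Polynomial F)) :
    Set (Matrix (Fin 2) (Fin 2) (RatFunc F)) :=
  {M | ∃ γ ∈ GammaT F, M = γ * g.map (algebraMap (Polynomial F) (RatFunc F))}

/-- Polynomial matrices with unit determinant that are congruent to the identity modulo `X`. -/
def IsCongruentOne {F : Type*} [Field F] (g : Matrix (Fin 2) (Fin 2) (Polynomial F)) : Prop :=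
  IsUnit g.det ∧ Polynomial.X ∣ (g 0 0 - 1) ∧ Polynomial.X ∣ (g 1 1 - 1) ∧
    Polynomial.X ∣ g 0 1 ∧ Polynomial.X ∣ g 1 0

theorem mem_GammaT_iff {F : Type*} [Field F] {M : Matrix (Fin 2) (Fin 2) (RatFunc F)} :
    M ∈ GammaT F ↔ ∃ g, IsCongruentOne g ∧ g.map (algebraMap (Polynomial F) (RatFunc F)) = M :=
  ⟨fun ⟨g, h, hM, h'⟩ => ⟨g, ⟨h, h'⟩, hM⟩, fun ⟨g, ⟨h, h'⟩, hM⟩ => ⟨g, h, hM, h'⟩⟩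

theorem IsCongruentOne.mul {F : Type*} [Field F] {g h : Matrix (Fin 2) (Fin 2) (Polynomial F)}
    (hg : IsCongruentOne g) (hh : IsCongruentOne h) : IsCongruentOne (g * h) := by
  obtain ⟨ug, ⟨a, ha⟩, ⟨b, hb⟩, ⟨c, hc⟩, ⟨e, he⟩⟩ := hg
  obtain ⟨uh, ⟨a', ha'⟩, ⟨b', hb'⟩, ⟨c', hc'⟩, ⟨e', he'⟩⟩ := hh
  rw [sub_eq_iff_eq_add] at ha hb ha' hb'
  refine ⟨by rw [Matrix.det_mul]; exact ug.mul uh, ?_, ?_, ?_, ?_⟩ <;>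
    simp only [Matrix.mul_apply, Fin.sum_univ_two, ha, hb, hc, he, ha', hb', hc', he']
  · exact ⟨X * a * a' + a + a' + X * c * e', by ring⟩
  · exact ⟨X * b * b' + b + b' + X * e * c', by ring⟩
  · exact ⟨X * a * c' + c' + X * c * b' + c, by ring⟩
  · exact ⟨X * e * a' + e + X * b * e' + e', by ring⟩

theorem map_mem_leftCoset'_iff {F : Type*} [Field F]
    {m g : Matrix (Fin 2) (Fin 2) (Polynomial F)} :
    m.map (algebraMap (Polynomial F) (RatFunc F)) ∈ leftCoset' F g ↔
      ∃ γ, IsCongruentOne γ ∧ m = γ * g := by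
  have inj := Matrix.map_injective (m := Fin 2) (n := Fin 2)
    (IsFractionRing.injective (Polynomial F) (RatFunc F))
  constructor
  · rintro ⟨M, hM, h⟩
    obtain ⟨γ, hγ, rfl⟩ := mem_GammaT_iff.1 hM
    exact ⟨γ, hγ, inj (h.trans Matrix.map_mul.symm)⟩
  · rintro ⟨γ, hγ, rfl⟩
    exact ⟨_, mem_GammaT_iff.2 ⟨γ, hγ, rfl⟩, by rw [Matrix.map_mul]⟩

theorem disjoint_leftCoset' {F : Type*} [Field F]
    {g h : Matrix (Fin 2) (Fin 2) (Polynomial F)}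
    (H : ∀ γ δ, IsCongruentOne γ → IsCongruentOne δ → γ * g ≠ δ * h) :
    Disjoint (leftCoset' F g) (leftCoset' F h) := by
  rw [Set.disjoint_left]
  rintro M ⟨N, hN, rfl⟩ hM
  obtain ⟨γ, hγ, rfl⟩ := mem_GammaT_iff.1 hN
  rw [← Matrix.map_mul] at hM
  obtain ⟨δ, hδ, h⟩ := map_mem_leftCoset'_iff.1 hM
  exact H γ δ hγ hδ h

theorem exists_degree_lt_dvd_sub_mul {F : Type*} [Field F] {P u : Polynomial F}
    (hP : Irreducible P) (hu : ¬ P ∣ u) (v : Polynomial F) :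
    ∃ b : Polynomial F, b.degree < P.degree ∧ P ∣ v - b * u := by
  obtain ⟨x, y, hxy⟩ := (hP.coprime_iff_not_dvd).2 hu
  refine ⟨(v * y) % P, EuclideanDomain.mod_lt _ hP.ne_zero, v * x + (v * y / P) * u, ?_⟩
  linear_combination -v * hxy - u * EuclideanDomain.div_add_mod (v * y) P

theorem X_dvd_of_X_dvd_mul {F : Type*} [Field F] {P e : Polynomial F} (hP : X ∣ P - 1)
    (h : X ∣ P * e) : X ∣ e := by
  have := dvd_sub h (hP.mul_right e)
  rwa [show P * e - (P - 1) * e = e by ring] at this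

theorem diag_mul_mem_leftCosets {F : Type*} [Field F] {P : Polynomial F} (hP : Irreducible P)
    (hX : X ∣ P - 1) {g : Matrix (Fin 2) (Fin 2) (Polynomial F)} (hg : IsCongruentOne g) :
    (∃ γ, IsCongruentOne γ ∧ !![P, 0; 0, 1] * g = γ * !![P, 0; 0, 1]) ∨
      ∃ b : Polynomial F, b.degree < P.degree ∧
        ∃ γ, IsCongruentOne γ ∧ !![P, 0; 0, 1] * g = γ * !![1, b * (1 - P); 0, P] := by
  obtain ⟨hu, h00, h11, h01, h10⟩ := hg
  rw [Matrix.det_fin_two] at hu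
  rw [Matrix.eta_fin_two g]
  by_cases hc : P ∣ g 1 0
  · left
    obtain ⟨e, he⟩ := hc
    refine ⟨!![g 0 0, P * g 0 1; e, g 1 1], ⟨?_, h00, h11, h01.mul_left P, ?_⟩, ?_⟩
    · rw [Matrix.det_fin_two_of]
      convert hu using 1
      rw [he]; ring
    · exact X_dvd_of_X_dvd_mul hX (he ▸ h10)
    · simp [he, mul_comm]
  · right
    obtain ⟨b, hb, k, hk⟩ := exists_degree_lt_dvd_sub_mul hP hc (g 1 1)
    have hX' : X ∣ b * (1 - P) := (dvd_sub_comm.1 hX).mul_left b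
    have hPe : P * (k + b * g 1 0) = g 1 1 - b * (1 - P) * g 1 0 := by
      linear_combination -hk
    refine ⟨b, hb, !![P * g 0 0, g 0 1 - b * (1 - P) * g 0 0; g 1 0, k + b * g 1 0],
      ⟨?_, ?_, ?_, ?_, h10⟩, ?_⟩
    · rw [Matrix.det_fin_two_of]
      convert hu using 1
      linear_combination g 0 0 * hPe
    · change X ∣ P * g 0 0 - 1
      rw [show P * g 0 0 - 1 = P * (g 0 0 - 1) + (P - 1) by ring]
      exact dvd_add (h00.mul_left P) hX
    · change X ∣ k + b * g 1 0 - 1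
      refine X_dvd_of_X_dvd_mul hX ?_
      rw [show P * (k + b * g 1 0 - 1) = (g 1 1 - 1) - (P - 1) - b * (1 - P) * g 1 0 by
        linear_combination hPe]
      exact dvd_sub (dvd_sub h11 hX) (h10.mul_left _)
    · exact dvd_sub h01 (hX'.mul_right _)
    · rw [Matrix.mul_fin_two, Matrix.mul_fin_two]
      refine Matrix.ext fun i j => ?_
      fin_cases i <;> fin_cases j <;> simp
      · ring
      · linear_combination -hPe

theorem exists_eq_mul_diag_mul {F : Type*} [Field F] {P c : Polynomial F} (hX : X ∣ P - 1)
    (hc : X ∣ c) :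
    ∃ γ δ, IsCongruentOne γ ∧ IsCongruentOne δ ∧
      !![1, c; 0, P] = γ * !![P, 0; 0, 1] * δ := by
  have hs : X ∣ 1 - P := dvd_sub_comm.1 hX
  have hs' : X ∣ 1 + (1 - P) - 1 := by simpa using hs
  refine ⟨!![1, -(1 - P); 1 - P, P * (1 + (1 - P))],
    !![1 + (1 - P), 1 - P; -(1 - P), P] * !![1, c; 0, 1], ⟨?_, ?_, ?_, ?_, ?_⟩,
    IsCongruentOne.mul ⟨?_, hs', hX, hs, (dvd_neg).2 hs⟩ ⟨?_, ?_, ?_, hc, ?_⟩, ?_⟩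
  · rw [Matrix.det_fin_two_of]
    convert isUnit_one using 1
    ring
  · simp
  · change X ∣ P * (1 + (1 - P)) - 1
    rw [show P * (1 + (1 - P)) - 1 = (P - 1) * (1 - P) by ring]
    exact hX.mul_right _
  · exact (dvd_neg).2 hs
  · exact hs
  · rw [Matrix.det_fin_two_of]
    convert isUnit_one using 1
    ring
  · simp
  · simp
  · simp
  · simp
  · simp only [Matrix.mul_fin_two]
    refine Matrix.ext fun i j => ?_
    fin_cases i <;> fin_cases j <;> simp <;> ring

theorem mul_diag_ne_mul_upper {F : Type*} [Field F] {P c : Polynomial F} (hP : Irreducible P)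
    {γ δ : Matrix (Fin 2) (Fin 2) (Polynomial F)} (hδ : IsUnit δ.det) :
    γ * !![P, 0; 0, 1] ≠ δ * !![1, c; 0, P] := by
  intro h
  have h0 := congrFun (congrFun h 0) 0
  have h1 := congrFun (congrFun h 1) 0
  simp [Matrix.mul_apply, Fin.sum_univ_two] at h0 h1
  refine hP.not_isUnit (isUnit_of_dvd_unit ?_ hδ)
  rw [Matrix.det_fin_two, ← h0, ← h1]
  exact ⟨γ 0 0 * δ 1 1 - δ 0 1 * γ 1 0, by ring⟩

theorem dvd_sub_of_mul_upper_eq_mul_upper {F : Type*} [Field F] {P c c' : Polynomial F}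
    {γ δ : Matrix (Fin 2) (Fin 2) (Polynomial F)} (hγ : IsUnit γ.det)
    (h : γ * !![1, c; 0, P] = δ * !![1, c'; 0, P]) : P ∣ c - c' := by
  have h00 := congrFun (congrFun h 0) 0
  have h10 := congrFun (congrFun h 1) 0
  have h01 := congrFun (congrFun h 0) 1
  have h11 := congrFun (congrFun h 1) 1
  simp [Matrix.mul_apply, Fin.sum_univ_two] at h00 h10 h01 h11
  rw [← h00] at h01
  rw [← h10] at h11
  rw [← hγ.dvd_mul_left, Matrix.det_fin_two]
  exact ⟨(δ 0 1 - γ 0 1) * γ 1 1 - γ 0 1 * (δ 1 1 - γ 1 1), by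
    linear_combination γ 1 1 * h01 - γ 0 1 * h11⟩

/-- The double coset decomposition
`Γ(T) diag(P,1) Γ(T) = Γ(T)·[[P,0],[0,1]] ⊔ ⨆_{deg b < d} Γ(T)·[[1,b(1-P)],[0,P]]`
for an irreducible `P ∈ F[T]` of degree `d ≥ 1` with `P(0) = 1`, together with the
pairwise disjointness of the `q^d + 1` left cosets. -/
theorem stmt_9 (F : Type*) [Field F] [Fintype F] (q : ℕ) (hq : Fintype.card F = q)
    (P : Polynomial F) (hirr : Irreducible P) (d : ℕ) (hd : P.natDegree = d)
    (hd1 : 1 ≤ d) (hP0 : P.eval 0 = 1) :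
    ({M : Matrix (Fin 2) (Fin 2) (RatFunc F) |
        ∃ γ₁ ∈ GammaT F, ∃ γ₂ ∈ GammaT F,
          M = γ₁ * (!![P, 0; 0, 1]).map (algebraMap (Polynomial F) (RatFunc F)) * γ₂} =
      leftCoset' F !![P, 0; 0, 1] ∪
        ⋃ b ∈ {b : Polynomial F | b.degree < (d : ℕ)},
          leftCoset' F !![1, b * (1 - P); 0, P]) ∧
    (∀ b : Polynomial F, b.degree < (d : ℕ) →
      Disjoint (leftCoset' F !![P, 0; 0, 1]) (leftCoset' F !![1, b * (1 - P); 0, P])) ∧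
    (∀ b b' : Polynomial F, b.degree < (d : ℕ) → b'.degree < (d : ℕ) → b ≠ b' →
      Disjoint (leftCoset' F !![1, b * (1 - P); 0, P])
        (leftCoset' F !![1, b' * (1 - P); 0, P])) := by
  have hX : X ∣ P - 1 := by
    rw [X_dvd_iff, coeff_sub, coeff_zero_eq_eval_zero, hP0]
    simp
  have hdeg : P.degree = (d : ℕ) := by rw [degree_eq_natDegree hirr.ne_zero, hd]
  refine ⟨Set.Subset.antisymm ?_ ?_, ?_, ?_⟩
  · rintro M ⟨M₁, h₁, M₂, h₂, rfl⟩
    obtain ⟨γ, hγ, rfl⟩ := mem_GammaT_iff.1 h₁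
    obtain ⟨g, hg, rfl⟩ := mem_GammaT_iff.1 h₂
    rw [← Matrix.map_mul, ← Matrix.map_mul, Matrix.mul_assoc]
    obtain ⟨δ, hδ, h⟩ | ⟨b, hb, δ, hδ, h⟩ := diag_mul_mem_leftCosets hirr hX hg
    · left
      exact map_mem_leftCoset'_iff.2 ⟨γ * δ, hγ.mul hδ, by rw [h, Matrix.mul_assoc]⟩
    · right
      refine Set.mem_biUnion (x := b) (hdeg ▸ hb) ?_
      exact map_mem_leftCoset'_iff.2 ⟨γ * δ, hγ.mul hδ, by rw [h, Matrix.mul_assoc]⟩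
  · rintro M (⟨N, hN, rfl⟩ | hM)
    · refine ⟨N, hN, 1, mem_GammaT_iff.2 ⟨1, by simp [IsCongruentOne], ?_⟩, by rw [mul_one]⟩
      exact Matrix.map_one _ (map_zero _) (map_one _)
    · simp only [Set.mem_iUnion] at hM
      obtain ⟨b, -, N, hN, rfl⟩ := hM
      obtain ⟨g, hg, rfl⟩ := mem_GammaT_iff.1 hN
      obtain ⟨γ, δ, hγ, hδ, h⟩ :=
        exists_eq_mul_diag_mul (c := b * (1 - P)) hX ((dvd_sub_comm.1 hX).mul_left b)
      refine ⟨_, mem_GammaT_iff.2 ⟨g * γ, hg.mul hγ, rfl⟩, _, mem_GammaT_iff.2 ⟨δ, hδ, rfl⟩, ?_⟩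
      rw [h]
      simp only [Matrix.map_mul, Matrix.mul_assoc]
  · exact fun b _ => disjoint_leftCoset' fun γ δ _ hδ => mul_diag_ne_mul_upper hirr hδ.1
  · refine fun b b' hb hb' hne => disjoint_leftCoset' fun γ δ hγ _ h => hne ?_
    obtain ⟨k, hk⟩ := dvd_sub_of_mul_upper_eq_mul_upper hγ.1 h
    rw [← sub_eq_zero]
    refine eq_zero_of_dvd_of_degree_lt (p := P) ⟨k + b - b', by linear_combination hk⟩ ?_
    rw [hdeg]
    exact (degree_sub_le b b').trans_lt (max_lt hb hb')
end

section
/- Let F be a finite field with q elements, let C be a field extension of the rational function field F(T), let k ≥ 2 be an integer, and fix r ∈ F. Let V be the C-vector space of homogeneous polynomials of degree k-2 in C[X,Y]. Then the set of f ∈ V satisfying f((1-rc)X + r^2 c Y, -cX + (1+rc)Y) = f(X,Y) for every c ∈ T·F[T] is exactly the one-dimensional subspace C·(X - rY)^{k-2}. -/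
open MvPolynomial

/-- The image in a field `C ⊇ F(T)` of a polynomial `c ∈ F[T]`. -/
noncomputable def liftC (F : Type*) [Field F] (C : Type*) [Field C]
    [Algebra (RatFunc F) C] (c : Polynomial F) : C :=
  algebraMap (RatFunc F) C (algebraMap (Polynomial F) (RatFunc F) c)

/-- The values of a homogeneous polynomial of degree `n` scale by the `n`-th power. -/
theorem MvPolynomial.IsHomogeneous.eval_const_mul {σ R : Type*} [CommSemiring R]
    {f : MvPolynomial σ R} {n : ℕ} (hf : f.IsHomogeneous n) (t : R) (x : σ → R) :
    eval (fun i => t * x i) f = t ^ n * eval x f := by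
  rw [eval_eq, eval_eq, Finset.mul_sum]
  refine Finset.sum_congr rfl fun d hd => ?_
  have hdeg : ∑ i ∈ d.support, d i = n := by
    have h := hf (mem_support_iff.mp hd)
    simpa [Finsupp.weight_apply, Finsupp.sum] using h
  rw [← hdeg, ← Finset.prod_pow_eq_pow_sum]
  simp only [mul_pow, Finset.prod_mul_distrib]
  ring

theorem liftC_injective (F : Type*) [Field F] (C : Type*) [Field C] [Algebra (RatFunc F) C] :
    Function.Injective (liftC F C) :=
  (algebraMap (RatFunc F) C).injective.comp (IsFractionRing.injective (Polynomial F) (RatFunc F))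

/-- A binary form of degree `n` that is invariant under `(x, y) ↦ (x, y) - c (x - ρy) (ρ, 1)` for
infinitely many `c` is a multiple of `(X - ρY) ^ n`. -/
theorem MvPolynomial.IsHomogeneous.eq_C_mul_pow_of_infinite_invariant {K : Type*} [Field K]
    {f : MvPolynomial (Fin 2) K} {n : ℕ} (hf : f.IsHomogeneous n) (ρ : K) {S : Set K}
    (hS : S.Infinite)
    (h : ∀ c ∈ S, ∀ x y : K,
      eval ![(1 - ρ * c) * x + ρ ^ 2 * c * y, -c * x + (1 + ρ * c) * y] f = eval ![x, y] f) :
    ∃ a : K, f = C a * (X 0 - C ρ * X 1) ^ n := by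
  have : Infinite K := Set.infinite_univ_iff.mp (hS.mono (Set.subset_univ S))
  let p : Polynomial K :=
    MvPolynomial.aeval ![1 - Polynomial.C ρ * Polynomial.X, -Polynomial.X] f
  have hp (c : K) : p.eval c = eval ![1 - ρ * c, -c] f := by
    have := map_aeval ![1 - Polynomial.C ρ * Polynomial.X, -Polynomial.X]
      (Polynomial.evalRingHom c) f
    simp only [p]
    rw [← Polynomial.coe_evalRingHom, this, eval, eval₂Hom_congr _ _ rfl]
    · ext; simp
    · ext i; fin_cases i <;> simp
  have hconst : p = Polynomial.C (eval ![1, 0] f) := by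
    refine Polynomial.eq_of_infinite_eval_eq _ _ (hS.mono fun c hc => ?_)
    have := h c hc 1 0
    simpa [hp] using this
  have hline (y : K) : eval ![1 + ρ * y, y] f = eval ![1, 0] f := by
    have := hp (-y)
    rw [hconst] at this
    simpa using this.symm
  refine ⟨eval ![1, 0] f, ?_⟩
  have hL : (X 0 - C ρ * X 1 : MvPolynomial (Fin 2) K) ≠ 0 := by
    intro h0
    simpa using congrArg (eval ![1, 0]) h0
  refine mul_right_cancel₀ hL (MvPolynomial.funext fun v => ?_)
  simp only [map_mul, map_sub, map_pow, eval_C, eval_X]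
  by_cases hv : v 0 - ρ * v 1 = 0
  · simp [hv]
  congr 1
  have hscale := hf.eval_const_mul (v 0 - ρ * v 1) ![1 + ρ * (v 1 / (v 0 - ρ * v 1)),
    v 1 / (v 0 - ρ * v 1)]
  rw [hline] at hscale
  rw [mul_comm, ← hscale]
  congr 2
  ext i
  fin_cases i
  · simp [mul_add, mul_left_comm _ ρ, mul_div_cancel₀ _ hv]
  · simp [mul_div_cancel₀ _ hv]

/-- For a field `C` extending `F(T)`, `k ≥ 2` and `r ∈ F`, the homogeneous polynomials of
degree `k - 2` in `C[X,Y]` fixed by all substitutions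
`X ↦ (1 - rc)X + r²cY`, `Y ↦ -cX + (1 + rc)Y` with `c ∈ T·F[T]` form exactly the line
`C · (X - rY)^{k-2}`. (These are the invariants of the stabilizer of the cusp `[r]`
of `Γ(T)`.) -/
theorem stmt_11 (F : Type*) [Field F] [Fintype F] (q : ℕ) (hq : Fintype.card F = q)
    (C : Type*) [Field C] [Algebra (RatFunc F) C] (k : ℕ) (hk : 2 ≤ k) (r : F) :
    {f : MvPolynomial (Fin 2) C | f.IsHomogeneous (k - 2) ∧
        ∀ c : Polynomial F, Polynomial.X ∣ c →
          MvPolynomial.bind₁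
            (fun i : Fin 2 =>
              if i = 0 then
                MvPolynomial.C (1 - liftC F C (Polynomial.C r) * liftC F C c) *
                    MvPolynomial.X 0 +
                  MvPolynomial.C (liftC F C (Polynomial.C r) ^ 2 * liftC F C c) *
                    MvPolynomial.X 1
              else
                -MvPolynomial.C (liftC F C c) * MvPolynomial.X 0 +
                  MvPolynomial.C (1 + liftC F C (Polynomial.C r) * liftC F C c) *
                    MvPolynomial.X 1) f = f} =
      {f : MvPolynomial (Fin 2) C | ∃ a : C,
        f = MvPolynomial.C a *
          (MvPolynomial.X 0 - MvPolynomial.C (liftC F C (Polynomial.C r)) *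
            MvPolynomial.X 1) ^ (k - 2)} := by
  ext f
  constructor
  · rintro ⟨hf, hinv⟩
    refine hf.eq_C_mul_pow_of_infinite_invariant (liftC F C (Polynomial.C r))
      (S := Set.range fun m : ℕ => liftC F C (Polynomial.X ^ (m + 1))) ?_ ?_
    · refine Set.infinite_range_of_injective ((liftC_injective F C).comp fun m n hmn => ?_)
      simpa using congrArg Polynomial.natDegree hmn
    · rintro _ ⟨m, rfl⟩ x y
      have h := congrArg (eval ![x, y]) (hinv _ (dvd_pow_self Polynomial.X m.succ_ne_zero))
      rw [← h]
      simp only [← coe_aeval_eq_eval, RingHom.coe_coe, aeval_bind₁]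
      congr 2
      ext i
      fin_cases i <;> simp
  · rintro ⟨a, rfl⟩
    refine ⟨?_, fun c _ => ?_⟩
    · have hL : (X 0 - MvPolynomial.C (liftC F C (Polynomial.C r)) * X 1 :
          MvPolynomial (Fin 2) C).IsHomogeneous 1 :=
        (isHomogeneous_X C 0).sub (isHomogeneous_C_mul_X _ 1)
      simpa using (isHomogeneous_C (Fin 2) a).mul (hL.pow (k - 2))
    · simp only [map_mul, map_pow, map_sub, bind₁_X_right, bind₁_C_right, if_true,
        one_ne_zero, if_false, map_add, map_one]
      congr 2
      ring
end

section
/- Let K = F_2(T) be the field of rational functions over the field with 2 elements, and let A be the 4×4 matrix over K given by A = [[1,0,0,0],[T^2,1,T^2,T^3],[T,T,1,T^3],[0,0,0,1]]. Then: (a) the characteristic polynomial of A equals (X-1)^2·((X-1)^2 - T^3); and (b) for every field extension L of K, the matrix A, viewed over L, is not diagonalizable, i.e., there do not exist an invertible 4×4 matrix Q and a diagonal 4×4 matrix D over L with Q⁻¹·A·Q = D. -/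
open Matrix Polynomial

noncomputable section

/-- The rational function field `K = F₂(T)`. -/
abbrev K2 : Type := RatFunc (ZMod 2)

/-- The variable `T` of `K = F₂(T)`. -/
noncomputable def t2 : K2 := RatFunc.X

/-- The matrix of the Hecke operator `T_𝔓`, `𝔓 = (1 + T)`, on the space of weight-5
Drinfeld cusp forms for `Γ₁(T)` when `q = 2`, in the basis `c₀, c₁, c₂, c₃`. -/
noncomputable def A12 : Matrix (Fin 4) (Fin 4) K2 :=
  !![1, 0, 0, 0;
     t2 ^ 2, 1, t2 ^ 2, t2 ^ 3;
     t2, t2, 1, t2 ^ 3;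
     0, 0, 0, 1]

/-- In characteristic two, a diagonalizable matrix `N` with `N⁴ = a N²` satisfies `N² = c N`
for some scalar `c`, since every nonzero eigenvalue is the unique square root of `a`. -/
theorem exists_sq_eq_smul_of_isDiag {n L : Type*} [Fintype n] [DecidableEq n] [Field L]
    [CharP L 2] {N Q E : Matrix n n L} (hQ : IsUnit Q.det) (hE : E.IsDiag)
    (h : Q⁻¹ * N * Q = E) {a : L} (hN : N ^ 4 = a • N ^ 2) : ∃ c : L, N ^ 2 = c • N := by
  obtain ⟨d, rfl⟩ : ∃ d, E = diagonal d := ⟨_, hE.diagonal_diag.symm⟩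
  have hNE : N = Q * diagonal d * Q⁻¹ := by
    rw [← h, mul_assoc, mul_assoc, mul_nonsing_inv _ hQ, mul_one,
      mul_nonsing_inv_cancel_left _ _ hQ]
  have hpow (k : ℕ) : Q⁻¹ * N ^ k * Q = diagonal (d ^ k) := by
    rw [← diagonal_pow, ← h]
    induction k with
    | zero => simp [nonsing_inv_mul _ hQ]
    | succ k ih =>
      rw [pow_succ (Q⁻¹ * N * Q), ← ih]
      simp only [mul_assoc, mul_nonsing_inv_cancel_left _ _ hQ, pow_succ]
  have hd (i : n) : d i ^ 4 = a * d i ^ 2 := by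
    have h4 := hpow 4
    rw [hN, mul_smul_comm, smul_mul_assoc, hpow 2] at h4
    simpa using (congrFun (congrFun h4 i) i).symm
  have hsq (i : n) (hi : d i ≠ 0) : d i ^ 2 = a :=
    mul_right_cancel₀ (pow_ne_zero 2 hi) (by rw [← hd i]; ring)
  obtain ⟨c, hc⟩ : ∃ c : L, d ^ 2 = c • d := by
    by_cases h0 : ∃ i, d i ≠ 0
    · obtain ⟨i, hi⟩ := h0
      refine ⟨d i, funext fun j ↦ ?_⟩
      by_cases hj : d j = 0
      · simp [hj]
      · have hij : d j = d i := CharTwo.sq_injective (by simp only [hsq j hj, hsq i hi])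
        simp [hij, sq]
    · push Not at h0
      exact ⟨0, funext fun j ↦ by simp [h0 j]⟩
  refine ⟨c, ?_⟩
  have h2 : N ^ 2 = Q * diagonal (d ^ 2) * Q⁻¹ := by
    rw [← hpow 2, mul_assoc, mul_assoc, mul_nonsing_inv _ hQ, mul_one,
      mul_nonsing_inv_cancel_left _ _ hQ]
  rw [h2, hc, diagonal_smul, mul_smul_comm, smul_mul_assoc, ← hNE]

theorem A12_sub_one : A12 - 1 =
    !![0, 0, 0, 0; t2 ^ 2, 0, t2 ^ 2, t2 ^ 3; t2, t2, 0, t2 ^ 3; 0, 0, 0, 0] := by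
  ext i j
  fin_cases i <;> fin_cases j <;> simp [A12]

theorem A12_sub_one_sq : (A12 - 1) ^ 2 =
    !![0, 0, 0, 0; t2 ^ 3, t2 ^ 3, 0, t2 ^ 5; t2 ^ 3, 0, t2 ^ 3, t2 ^ 4; 0, 0, 0, 0] := by
  rw [A12_sub_one, sq]
  ext i j
  fin_cases i <;> fin_cases j <;> simp [mul_apply, Fin.sum_univ_four] <;> ring

theorem A12_sub_one_pow_four : (A12 - 1) ^ 4 = t2 ^ 3 • (A12 - 1) ^ 2 := by
  rw [pow_mul (A12 - 1) 2 2, A12_sub_one_sq, sq]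
  ext i j
  fin_cases i <;> fin_cases j <;> simp [mul_apply, Fin.sum_univ_four]

theorem A12_charpoly :
    A12.charpoly = (Polynomial.X - 1) ^ 2 * ((Polynomial.X - 1) ^ 2 - Polynomial.C (t2 ^ 3)) := by
  rw [charpoly, det_succ_row_zero]
  simp [Fin.sum_univ_succ, det_fin_three, charmatrix_apply, A12, submatrix_apply, Fin.succAbove]
  ring

/-- Example 7.2 of Li–Meemark: (a) the characteristic polynomial of `A12` is
`(X-1)² ((X-1)² - T³)`, and (b) `A12` is not diagonalizable over any field extension
of `K = F₂(T)`. -/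
theorem stmt_12 :
    A12.charpoly = (Polynomial.X - 1) ^ 2 * ((Polynomial.X - 1) ^ 2 - Polynomial.C (t2 ^ 3)) ∧
    ∀ (L : Type) [Field L] [Algebra K2 L],
      ¬ ∃ (Q D : Matrix (Fin 4) (Fin 4) L),
        IsUnit Q.det ∧ D.IsDiag ∧ Q⁻¹ * A12.map (algebraMap K2 L) * Q = D := by
  refine ⟨A12_charpoly, ?_⟩
  rintro L _ _ ⟨Q, D, hQ, hD, h⟩
  have : CharP K2 2 := charP_of_injective_algebraMap (algebraMap (ZMod 2) K2).injective 2
  have : CharP L 2 := charP_of_injective_algebraMap (algebraMap K2 L).injective 2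
  let φ := (algebraMap K2 L).mapMatrix (m := Fin 4)
  have hE : Q⁻¹ * φ (A12 - 1) * Q = D - 1 := by
    rw [← h, map_sub, map_one, mul_sub, sub_mul, mul_one, nonsing_inv_mul _ hQ]
    rfl
  have hN : φ (A12 - 1) ^ 4 = algebraMap K2 L (t2 ^ 3) • φ (A12 - 1) ^ 2 := by
    rw [← map_pow, A12_sub_one_pow_four, ← map_pow]
    ext i j
    simp [φ]
  obtain ⟨c, hc⟩ := exists_sq_eq_smul_of_isDiag hQ (hD.sub isDiag_one) hE hN
  rw [← map_pow, A12_sub_one_sq, A12_sub_one] at hc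
  have h11 := congrFun (congrFun hc 1) 1
  simp [φ, t2, RatFunc.X_ne_zero] at h11
end
end

section
/- Let K = F_3(T) be the field of rational functions over the field with 3 elements, and consider the 3×3 matrices over K: A = [[1,0,0],[2T^3,1,T^3],[2T,2T,1+2T]] and B = [[1+2T,2T^3,2T^4],[T,1,2T^5],[0,0,1]]. Then: (a) A and B have the same characteristic polynomial, namely (X-1)·((X-(1+T))^2 - T^2·(1-T^2)); (b) in any field extension L of K containing an element s with s^2 = 1 - T^2, this polynomial has the three pairwise distinct roots 1, 1+T+Ts, 1+T-Ts; and (c) over any such L, both A and B are diagonalizable, i.e., each is similar over L to a diagonal matrix. -/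
open Matrix Polynomial

noncomputable section

/-- The rational function field `K = F₃(T)`. -/
abbrev K3 : Type := RatFunc (ZMod 3)

/-- The variable `T` of `K = F₃(T)`. -/
noncomputable def t3 : K3 := RatFunc.X

/-- The matrix `[T_𝔓]₀` of the Hecke operator `T_𝔓`, `𝔓 = (1 + T)`, on the invariant
subspace of weight-7 Drinfeld cusp forms for `Γ₁(T)` spanned by `c₀, c₂, c₄` (`q = 3`). -/
noncomputable def A14 : Matrix (Fin 3) (Fin 3) K3 :=
  !![1, 0, 0;
     2 * t3 ^ 3, 1, t3 ^ 3;
     2 * t3, 2 * t3, 1 + 2 * t3]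

/-- The matrix `[T_𝔓]₁` of the Hecke operator `T_𝔓`, `𝔓 = (1 + T)`, on the invariant
subspace of weight-7 Drinfeld cusp forms for `Γ₁(T)` spanned by `c₁, c₃, c₅` (`q = 3`). -/
noncomputable def B14 : Matrix (Fin 3) (Fin 3) K3 :=
  !![1 + 2 * t3, 2 * t3 ^ 3, 2 * t3 ^ 4;
     t3, 1, 2 * t3 ^ 5;
     0, 0, 1]

theorem Matrix.inv_mul_mul_eq_of_mul_eq_mul {n R : Type*} [Fintype n] [DecidableEq n] [CommRing R]
    {M Q D : Matrix n n R} (hQ : IsUnit Q.det) (h : M * Q = Q * D) : Q⁻¹ * M * Q = D := by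
  rw [Matrix.mul_assoc, h, Matrix.nonsing_inv_mul_cancel_left _ _ hQ]

theorem three_eq_zero_K3 : (3 : K3) = 0 :=
  CharP.cast_eq_zero K3 3

theorem t3_ne_zero : t3 ≠ 0 :=
  RatFunc.X_ne_zero

theorem one_sub_t3_sq_ne_zero : 1 - t3 ^ 2 ≠ 0 := by
  have hX : (1 - Polynomial.X ^ 2 : (ZMod 3)[X]) ≠ 0 := by
    intro h
    simpa using congrArg (Polynomial.eval 0) h
  simpa [t3] using (map_ne_zero_iff _ (RatFunc.algebraMap_injective (ZMod 3))).mpr hX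

theorem two_eq_neg_one_K3 : (2 : K3) = -1 := by
  linear_combination three_eq_zero_K3

theorem A14_charpoly :
    A14.charpoly = (Polynomial.X - 1) *
      ((Polynomial.X - Polynomial.C (1 + t3)) ^ 2 -
        Polynomial.C (t3 ^ 2 * (1 - t3 ^ 2))) := by
  have h3 : (3 : K3[X]) = 0 := by
    simpa only [map_ofNat, map_zero] using congrArg (Polynomial.C : K3 →+* K3[X]) three_eq_zero_K3
  simp [Matrix.charpoly, Matrix.det_fin_three, A14, two_eq_neg_one_K3]
  linear_combination (Polynomial.X - 1) ^ 2 * Polynomial.C t3 * h3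

theorem B14_charpoly :
    B14.charpoly = (Polynomial.X - 1) *
      ((Polynomial.X - Polynomial.C (1 + t3)) ^ 2 -
        Polynomial.C (t3 ^ 2 * (1 - t3 ^ 2))) := by
  have h3 : (3 : K3[X]) = 0 := by
    simpa only [map_ofNat, map_zero] using congrArg (Polynomial.C : K3 →+* K3[X]) three_eq_zero_K3
  simp [Matrix.charpoly, Matrix.det_fin_three, B14, two_eq_neg_one_K3]
  linear_combination (Polynomial.X - 1) ^ 2 * Polynomial.C t3 * h3

/-- Example 7.1 of Li–Meemark: (a) `A14` and `B14` have the same characteristic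
polynomial `(X - 1)((X - (1+T))² - T²(1 - T²))`; (b) over any field extension `L` of
`K = F₃(T)` containing `s` with `s² = 1 - T²`, this polynomial has the three pairwise
distinct roots `1`, `1 + T + Ts`, `1 + T - Ts`; and (c) over any such `L`, both `A14`
and `B14` are diagonalizable. -/
theorem stmt_14 :
    (A14.charpoly = B14.charpoly ∧
      A14.charpoly =
        (Polynomial.X - 1) *
          ((Polynomial.X - Polynomial.C (1 + t3)) ^ 2 -
            Polynomial.C (t3 ^ 2 * (1 - t3 ^ 2)))) ∧
    ∀ (L : Type) [Field L] [Algebra K3 L] (s : L),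
      s ^ 2 = algebraMap K3 L (1 - t3 ^ 2) →
      ((1 : L) ≠ 1 + algebraMap K3 L t3 + algebraMap K3 L t3 * s ∧
        (1 : L) ≠ 1 + algebraMap K3 L t3 - algebraMap K3 L t3 * s ∧
        1 + algebraMap K3 L t3 + algebraMap K3 L t3 * s ≠
          1 + algebraMap K3 L t3 - algebraMap K3 L t3 * s) ∧
      (Polynomial.aeval (1 : L) A14.charpoly = 0 ∧
        Polynomial.aeval (1 + algebraMap K3 L t3 + algebraMap K3 L t3 * s) A14.charpoly = 0 ∧
        Polynomial.aeval (1 + algebraMap K3 L t3 - algebraMap K3 L t3 * s) A14.charpoly = 0) ∧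
      (∃ Q D : Matrix (Fin 3) (Fin 3) L,
        IsUnit Q.det ∧ D.IsDiag ∧ Q⁻¹ * A14.map (algebraMap K3 L) * Q = D) ∧
      (∃ Q D : Matrix (Fin 3) (Fin 3) L,
        IsUnit Q.det ∧ D.IsDiag ∧ Q⁻¹ * B14.map (algebraMap K3 L) * Q = D) := by
  refine ⟨⟨A14_charpoly.trans B14_charpoly.symm, A14_charpoly⟩, fun L _ _ s hs => ?_⟩
  have h3 : (3 : L) = 0 := by
    simpa only [map_ofNat, map_zero] using congrArg (algebraMap K3 L) three_eq_zero_K3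
  have ht : algebraMap K3 L t3 ≠ 0 := (_root_.map_ne_zero _).mpr t3_ne_zero
  have hs0 : s ≠ 0 := by
    rintro rfl
    exact (_root_.map_ne_zero (algebraMap K3 L)).mpr one_sub_t3_sq_ne_zero (by rw [← hs]; simp)
  rw [A14_charpoly]
  simp only [map_sub, map_one, map_pow] at hs
  have hA : A14.map (algebraMap K3 L) = let t := algebraMap K3 L t3
      !![1, 0, 0; -t ^ 3, 1, t ^ 3; -t, -t, 1 - t] := by
    ext i j
    fin_cases i <;> fin_cases j <;> simp [A14, two_eq_neg_one_K3, sub_eq_add_neg]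
  have hB : B14.map (algebraMap K3 L) = let t := algebraMap K3 L t3
      !![1 - t, -t ^ 3, -t ^ 4; t, 1, -t ^ 5; 0, 0, 1] := by
    ext i j
    fin_cases i <;> fin_cases j <;> simp [B14, two_eq_neg_one_K3, sub_eq_add_neg]
  simp only [hA, hB, map_mul, map_sub, map_pow, map_add, map_one, aeval_X, aeval_C]
  generalize algebraMap K3 L t3 = t at *
  refine ⟨⟨fun h => ?_, fun h => ?_, fun h => ?_⟩, ⟨?_, ?_, ?_⟩, ?_, ?_⟩
  · have h1 : s = -1 := mul_left_cancel₀ ht (by linear_combination -h)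
    exact ht (pow_eq_zero_iff two_ne_zero |>.mp (by rw [h1] at hs; linear_combination hs))
  · have h1 : s = 1 := mul_left_cancel₀ ht (by linear_combination h)
    exact ht (pow_eq_zero_iff two_ne_zero |>.mp (by rw [h1] at hs; linear_combination hs))
  · exact mul_ne_zero ht hs0 (by linear_combination -h + t * s * h3)
  · ring
  · linear_combination (t + t * s) * t ^ 2 * hs
  · linear_combination (t - t * s) * t ^ 2 * hs
  · let Q : Matrix (Fin 3) (Fin 3) L := !![1, 0, 0; 1, t ^ 2, t ^ 2; 1, 1 + s, 1 - s]
    have hQ : Q.det = t ^ 2 * s := by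
      simp [Q, Matrix.det_fin_three]
      linear_combination -t ^ 2 * s * h3
    refine ⟨Q, Matrix.diagonal ![1, 1 + t + t * s, 1 + t - t * s], ?_,
      Matrix.isDiag_diagonal _, Matrix.inv_mul_mul_eq_of_mul_eq_mul ?_ ?_⟩
    iterate 2 exact hQ ▸ (mul_ne_zero (pow_ne_zero 2 ht) hs0).isUnit
    ext i j
    fin_cases i <;> fin_cases j <;>
      simp [Q, Matrix.mul_apply, Fin.sum_univ_three, Matrix.diagonal_apply]
    all_goals
      first
      | ring1
      | linear_combination -t * hs - (t + t * s) * h3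
      | linear_combination -t * hs - (t - t * s) * h3
      | linear_combination -t * h3
  · let Q : Matrix (Fin 3) (Fin 3) L := !![t ^ 4, 1 + s, 1 - s; -t ^ 2 - t, 1, 1; 1, 0, 0]
    have hQ : Q.det = -s := by
      simp [Q, Matrix.det_fin_three]
      linear_combination s * h3
    refine ⟨Q, Matrix.diagonal ![1, 1 + t + t * s, 1 + t - t * s], ?_,
      Matrix.isDiag_diagonal _, Matrix.inv_mul_mul_eq_of_mul_eq_mul ?_ ?_⟩
    iterate 2 exact hQ ▸ (neg_ne_zero.mpr hs0).isUnit
    ext i j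
    fin_cases i <;> fin_cases j <;>
      simp [Q, Matrix.mul_apply, Fin.sum_univ_three, Matrix.diagonal_apply]
    all_goals
      first
      | ring1
      | linear_combination -t * hs - (t + t * s) * h3
      | linear_combination -t * hs - (t - t * s) * h3
end
end

section
/- Let F be a finite field with q elements and characteristic p, and let A = F[T]. Let γ ∈ GL_2(A) satisfy the congruences γ₁₁ ≡ 1, γ₂₂ ≡ 1 and γ₂₁ ≡ 0 modulo T (i.e., γ lies in the congruence subgroup Γ_1(T)). If γ has finite order n ≥ 1, then n is a power of p. In particular, the groups Γ_1(T) and Γ(T) ⊆ Γ_1(T) contain no nontrivial torsion of order prime to p. -/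
open Matrix Polynomial

theorem pow_eq_of_unitriangular {R : Type*} [CommRing R] (b : R) (n : ℕ) :
    !![1, b; 0, 1] ^ n = !![1, n * b; 0, 1] := by
  induction n with
  | zero => simp [Matrix.one_fin_two]
  | succ n ih =>
    rw [pow_succ, ih]
    simp
    ring

/-- The kernel of reduction modulo `X` on matrices has no torsion of order invertible in `F`. -/
theorem eq_one_of_pow_eq_one_of_map_eval_zero {F ι : Type*} [Field F] [Fintype ι] [DecidableEq ι]
    (δ : Matrix ι ι F[X]) (hδ : (evalRingHom (0 : F)).mapMatrix δ = 1)
    (m : ℕ) (hm : (m : F) ≠ 0) (h : δ ^ m = 1) : δ = 1 := by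
  have hmap : (evalRingHom (0 : F)).mapMatrix (∑ i ∈ Finset.range m, δ ^ i) = m := by
    rw [map_sum]
    simp only [map_pow, hδ, one_pow, Finset.sum_const, Finset.card_range, nsmul_eq_mul, mul_one]
  have hdet : (∑ i ∈ Finset.range m, δ ^ i).det ≠ 0 := by
    intro h0
    have h1 := (evalRingHom (0 : F)).map_det (∑ i ∈ Finset.range m, δ ^ i)
    rw [hmap, h0, map_zero, ← Matrix.diagonal_natCast, Matrix.det_diagonal, eq_comm] at h1
    simp [Finset.prod_const, pow_eq_zero_iff', hm] at h1
  have hz : (∑ i ∈ Finset.range m, δ ^ i) * (δ - 1) = 0 := by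
    rw [geom_sum_mul, h, sub_self]
  have hadj := congrArg ((∑ i ∈ Finset.range m, δ ^ i).adjugate * ·) hz
  simp only [← mul_assoc, Matrix.adjugate_mul, smul_mul_assoc, one_mul, mul_zero] at hadj
  exact sub_eq_zero.mp ((smul_eq_zero.mp hadj).resolve_left hdet)

/-- The congruence subgroups `Γ₁(T)` (and hence `Γ(T) ⊆ Γ₁(T)`) of `GL₂(F[T])` are
`p'`-torsion free: if `γ ∈ GL₂(F[T])` satisfies `γ₁₁ ≡ γ₂₂ ≡ 1` and `γ₂₁ ≡ 0 mod T`
and `γ` has finite order `n ≥ 1`, then `n` is a power of the characteristic `p`. -/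
theorem stmt_15 (F : Type*) [Field F] [Fintype F] (q p : ℕ) (hq : Fintype.card F = q)
    (hp : CharP F p) (γ : Matrix (Fin 2) (Fin 2) (Polynomial F))
    (hdet : IsUnit γ.det)
    (h11 : Polynomial.X ∣ (γ 0 0 - 1)) (h22 : Polynomial.X ∣ (γ 1 1 - 1))
    (h21 : Polynomial.X ∣ γ 1 0)
    (n : ℕ) (hn : 1 ≤ n) (hord : orderOf γ = n) :
    ∃ k : ℕ, n = p ^ k := by
  have hprime : p.Prime := CharP.char_is_prime F p
  obtain ⟨k, m, hm, hnm⟩ :=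
    Nat.exists_eq_pow_mul_and_not_dvd (Nat.one_le_iff_ne_zero.mp hn) p hprime.ne_one
  have hmF : (m : F) ≠ 0 := fun h => hm ((CharP.cast_eq_zero_iff F p m).mp h)
  have hred : (evalRingHom (0 : F)).mapMatrix γ = !![1, (γ 0 1).eval 0; 0, 1] := by
    rw [X_dvd_iff, coeff_zero_eq_eval_zero] at h11 h22 h21
    rw [eval_sub, eval_one, sub_eq_zero] at h11 h22
    ext i j
    fin_cases i <;> fin_cases j <;> simp [h11, h22, h21]
  have hone : γ ^ (p ^ (k + 1)) = 1 := by
    refine eq_one_of_pow_eq_one_of_map_eval_zero _ ?_ m hmF ?_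
    · rw [map_pow, hred, pow_eq_of_unitriangular]
      simp [Matrix.one_fin_two]
    · rw [← pow_mul, ← orderOf_dvd_iff_pow_eq_one, hord, hnm]
      exact ⟨p, by ring⟩
  obtain ⟨j, -, hj⟩ := (Nat.dvd_prime_pow hprime).mp (orderOf_dvd_of_pow_eq_one hone)
  exact ⟨j, hord ▸ hj⟩
end

section
/- Let F be a finite field with q ≥ 5 elements and characteristic p, and let a be a generator of F^×. Let D be the (q-1)×(q-1) matrix over F with rows and columns indexed by residues i, n ∈ Z/(q-1), defined by D(i,n) = (1 - a^{n-i})^{-3} for n ≠ i and D(i,i) = 0 (the exponent n-i taken modulo q-1). Then for every integer j with 1 ≤ j ≤ q-1, the vector v_j with entries v_j(n) = a^{nj} satisfies D · v_j = binom(j,3) · v_j, where binom(j,3) is the binomial coefficient reduced into F; i.e., v_j is an eigenvector of D with eigenvalue binom(j,3). -/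
open Finset Matrix

/-- The power sum `∑ x ^ j / (1 - x) ^ 3` over the units of a finite field; the junk value of the
inverse at `0` makes the term at `x = 1` vanish. -/
theorem FiniteField.sum_units_pow_mul_inv_one_sub_pow_three (F : Type*) [Field F] [Fintype F]
    [DecidableEq F]
    (hF : 5 ≤ Fintype.card F) {j : ℕ} (hj : 1 ≤ j) (hj' : j ≤ Fintype.card F - 1) :
    ∑ x : Fˣ, (x : F) ^ j * ((1 - (x : F))⁻¹) ^ 3 = (j.choose 3 : F) := by
  have units_sum (f : F → F) (hf : f 0 = 0) : ∑ x : Fˣ, f x = ∑ x : F, f x := by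
    rw [Fintype.sum_eq_add_sum_subtype_ne f 0, hf, zero_add]
    exact Fintype.sum_equiv unitsEquivNeZero _ _ fun _ => rfl
  rw [units_sum (fun x => x ^ j * ((1 - x)⁻¹) ^ 3) (by simp [show j ≠ 0 by omega]),
    ← (Equiv.subLeft (1 : F)).sum_comp]
  simp only [Equiv.subLeft_apply, sub_sub_cancel]
  rw [← units_sum (fun x => (1 - x) ^ j * (x⁻¹) ^ 3) (by simp)]
  have expand (x : Fˣ) : (1 - (x : F)) ^ j * ((x : F)⁻¹) ^ 3 =
      ∑ k ∈ range (j + 1), (-1) ^ k * (j.choose k : F) *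
        (x : F) ^ (k + (Fintype.card F - 4)) := by
    have hinv : ((x : F)⁻¹) ^ 3 = (x : F) ^ (Fintype.card F - 4) := by
      rw [inv_pow]
      refine inv_eq_of_mul_eq_one_right ?_
      rw [← pow_add, show 3 + (Fintype.card F - 4) = Fintype.card F - 1 by omega]
      exact FiniteField.pow_card_sub_one_eq_one _ x.ne_zero
    rw [hinv, sub_eq_neg_add, add_pow, sum_mul]
    refine sum_congr rfl fun k _ => ?_
    rw [neg_pow, pow_add]
    ring
  simp_rw [expand]
  rw [sum_comm]
  simp_rw [← mul_sum, FiniteField.sum_pow_units]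
  have hdvd {k : ℕ} (hk : k ∈ range (j + 1)) :
      Fintype.card F - 1 ∣ k + (Fintype.card F - 4) ↔ k = 3 := by
    rw [mem_range] at hk
    constructor
    · rintro ⟨c, hc⟩
      have h0 : 0 < c := Nat.pos_of_ne_zero (by rintro rfl; omega)
      have h2 : c < 2 := by
        by_contra! h
        have := Nat.mul_le_mul_left (Fintype.card F - 1) h
        omega
      obtain rfl : c = 1 := by omega
      omega
    · rintro rfl
      exact ⟨1, by omega⟩
  rw [sum_congr rfl fun k hk => by rw [if_congr (hdvd hk) rfl rfl]]
  simp only [mul_ite, mul_zero, sum_ite_eq', mem_range]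
  split_ifs with h
  · ring
  · rw [Nat.choose_eq_zero_of_lt (by omega), Nat.cast_zero]

/-- Exponentiating a generator of a finite group of order `m` identifies the group with `ZMod m`. -/
theorem bijective_pow_zmod_val {G : Type*} [Group G] [Fintype G] {m : ℕ} [NeZero m]
    (hm : Fintype.card G = m) {a : G} (ha : ∀ x : G, x ∈ Subgroup.zpowers a) :
    Function.Bijective fun n : ZMod m => a ^ n.val := by
  have ho : orderOf a = m := by
    rw [orderOf_eq_card_of_forall_mem_zpowers ha, Nat.card_eq_fintype_card, hm]
  rw [Fintype.bijective_iff_injective_and_card]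
  refine ⟨fun x y h => ZMod.val_injective m (pow_injOn_Iio_orderOf ?_ ?_ h), by simp [hm]⟩
  · simpa [ho] using x.val_lt
  · simpa [ho] using y.val_lt

/-- The circulant matrix `D` with entries `D(i,n) = (1 - a^{n-i})⁻³` for `n ≠ i` and
zero diagonal (indices in `ℤ/(q-1)`), arising in the weight-5 analysis for `Γ(T)`,
has for each `1 ≤ j ≤ q-1` the eigenvector `v_j(n) = a^{nj}` with eigenvalue the
binomial coefficient `binom(j,3)` reduced into `F`. -/
theorem stmt_16 (F : Type*) [Field F] [Fintype F] (q p : ℕ) (hq : Fintype.card F = q)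
    (hq5 : 5 ≤ q) (hp : CharP F p) [NeZero (q - 1)]
    (a : Fˣ) (ha : ∀ x : Fˣ, x ∈ Subgroup.zpowers a) :
    ∀ j : ℕ, 1 ≤ j → j ≤ q - 1 →
      (Matrix.of fun i n : ZMod (q - 1) =>
          if n = i then (0 : F) else ((1 - (a : F) ^ (n - i).val)⁻¹) ^ 3).mulVec
        (fun n : ZMod (q - 1) => (a : F) ^ (n.val * j)) =
      (j.choose 3 : F) • fun n : ZMod (q - 1) => (a : F) ^ (n.val * j) := by
  classical
  intro j hj hj'
  subst hq
  have hcard : Fintype.card Fˣ = Fintype.card F - 1 := Fintype.card_units F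
  have hbij := bijective_pow_zmod_val hcard ha
  have hadd (m i : ZMod (Fintype.card F - 1)) :
      (a : F) ^ (m + i).val = (a : F) ^ m.val * (a : F) ^ i.val := by
    rw [ZMod.val_add, ← pow_add]
    exact (pow_eq_pow_mod _ (FiniteField.pow_card_sub_one_eq_one _ a.ne_zero)).symm
  ext i
  simp only [Matrix.mulVec, dotProduct, Matrix.of_apply, Pi.smul_apply, smul_eq_mul]
  rw [← FiniteField.sum_units_pow_mul_inv_one_sub_pow_three F hq5 hj hj', ← hbij.sum_comp, sum_mul,
    ← Equiv.sum_comp (Equiv.addRight i)]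
  refine sum_congr rfl fun m _ => ?_
  simp only [Equiv.coe_addRight, add_sub_cancel_right, add_eq_right, pow_mul, hadd, mul_pow,
    Units.val_pow_eq_pow_val]
  split_ifs with h
  · simp [h]
  · ring
end
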